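/- arXiv:2411.05471 — 8 statements merged into one kernel-verified Lean document; each statement's English description precedes it below -/
import Mathlib

section
/- Let r ≥ 1 be an integer and let f : ℕ → {-1,+1} be a binary arithmetic function satisfying f(2n) = -f(n) for all n = 1, 2, …, 2^{r-1} - 1. Let B : 𝔽₂^r → 𝔽₂ be any Boolean function satisfying f(∑_{j=1}^r n_j 2^{j-1}) = (-1)^{B(n_1,…,n_r)} for all (n_1,…,n_r) ∈ 𝔽₂^r \ {(0,…,0)} (the value B(0,…,0) is arbitrary). Then the algebraic degree of B satisfies deg(B) ≥ r - 1, and the sparsity of B satisfies spr(B) ≥ ⌊2^r/3⌋. -/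
open scoped BigOperators

/-- Algebraic normal form coefficient `a_I` of the Boolean function `B` in `r` variables,
obtained by Möbius inversion over `𝔽₂`. -/
def anf {r : ℕ} (B : (Fin r → ZMod 2) → ZMod 2) (I : Finset (Fin r)) : ZMod 2 :=
  ∑ J ∈ I.powerset, B (fun i => if i ∈ J then 1 else 0)

/-- Sparsity (algebraic thickness): the number of nonzero ANF coefficients. -/
def sparsity {r : ℕ} (B : (Fin r → ZMod 2) → ZMod 2) : ℕ :=
  (Finset.univ.filter fun I : Finset (Fin r) => anf B I ≠ 0).card

/-- Algebraic degree: the maximal `|I|` with `a_I = 1` (and `0` for the zero function). -/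
def algDeg {r : ℕ} (B : (Fin r → ZMod 2) → ZMod 2) : ℕ :=
  (Finset.univ.filter fun I : Finset (Fin r) => anf B I ≠ 0).sup Finset.card

/-- The integer `∑_{j=1}^r n_j 2^{j-1}` corresponding to the bit vector `(n_1,…,n_r)`. -/
def bitVal {r : ℕ} (x : Fin r → ZMod 2) : ℕ :=
  ∑ j : Fin r, (x j).val * 2 ^ (j : ℕ)

lemma anf_map {r s : ℕ} (B : (Fin r → ZMod 2) → ZMod 2) (e : Fin s ↪ Fin r)
    (I : Finset (Fin s)) :
    anf B (I.map e) = ∑ J ∈ I.powerset, B (fun i => if i ∈ J.map e then 1 else 0) := by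
  classical
  have h : (I.map e).powerset = I.powerset.map (Finset.mapEmbedding e).toEmbedding := by
    ext K
    simp only [Finset.mem_powerset, Finset.mem_map, Finset.subset_map_iff]
    constructor
    · rintro ⟨J, hJ, rfl⟩
      exact ⟨J, hJ, rfl⟩
    · rintro ⟨J, hJ, rfl⟩
      exact ⟨J, hJ, rfl⟩
  rw [anf, h, Finset.sum_map]
  rfl

lemma bitVal_map_castSucc {s : ℕ} (J : Finset (Fin s)) :
    bitVal (fun i : Fin (s + 1) => if i ∈ J.map Fin.castSuccEmb then (1 : ZMod 2) else 0) =
      ∑ j ∈ J, 2 ^ (j : ℕ) := by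
  simp only [bitVal, Fin.sum_univ_castSucc]
  simp [apply_ite ZMod.val, ZMod.val_one]

lemma bitVal_map_succ {s : ℕ} (J : Finset (Fin s)) :
    bitVal (fun i : Fin (s + 1) => if i ∈ J.map (Fin.succEmb s) then (1 : ZMod 2) else 0) =
      2 * ∑ j ∈ J, 2 ^ (j : ℕ) := by
  simp only [bitVal, Fin.sum_univ_succ]
  simp [apply_ite ZMod.val, ZMod.val_one, pow_succ', Finset.mul_sum]

lemma sum_two_pow_fin_le {s : ℕ} (J : Finset (Fin s)) :
    ∑ j ∈ J, 2 ^ (j : ℕ) ≤ 2 ^ s - 1 := by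
  calc ∑ j ∈ J, 2 ^ (j : ℕ) ≤ ∑ j : Fin s, 2 ^ (j : ℕ) :=
        Finset.sum_le_sum_of_subset (Finset.subset_univ J)
    _ = ∑ j ∈ Finset.range s, 2 ^ j := Fin.sum_univ_eq_sum_range (fun j => 2 ^ j) s
    _ = 2 ^ s - 1 := Nat.geomSum_eq le_rfl s |>.trans (by simp)

/-- If `B` flips under the shift of nonempty bit sets, then so do its ANF coefficients. -/
lemma anf_map_succ_add_anf_map_castSucc {s : ℕ} (B : (Fin (s + 1) → ZMod 2) → ZMod 2)
    (h : ∀ J : Finset (Fin s), J.Nonempty →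
      B (fun i => if i ∈ J.map (Fin.succEmb s) then 1 else 0) +
        B (fun i => if i ∈ J.map Fin.castSuccEmb then 1 else 0) = 1)
    {I : Finset (Fin s)} (hI : I.Nonempty) :
    anf B (I.map (Fin.succEmb s)) + anf B (I.map Fin.castSuccEmb) = 1 := by
  rw [anf_map, anf_map, ← Finset.sum_add_distrib]
  have : ∀ J ∈ I.powerset, B (fun i => if i ∈ J.map (Fin.succEmb s) then 1 else 0) +
        B (fun i => if i ∈ J.map Fin.castSuccEmb then 1 else 0) =
        1 - if J = ∅ then 1 else 0 := by
    intro J _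
    split_ifs with hJ
    · subst hJ
      simp [CharTwo.add_self_eq_zero]
    · simpa using h J (Finset.nonempty_iff_ne_empty.2 hJ)
  have h2 : (2 : ZMod 2) = 0 := rfl
  rw [Finset.sum_congr rfl this, Finset.sum_sub_distrib]
  simp [h2, zero_pow hI.card_pos.ne']

lemma sum_range_two_mul (h : ℕ → ℕ) (N : ℕ) :
    ∑ n ∈ Finset.range (2 * N), h n =
      ∑ n ∈ Finset.range N, h (2 * n) + ∑ n ∈ Finset.range N, h (2 * n + 1) := by
  induction N with
  | zero => simp
  | succ N ih =>
    rw [show 2 * (N + 1) = 2 * N + 1 + 1 by ring]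
    simp only [Finset.sum_range_succ, ih]
    ring

/-- A vertex cover of the graph with edges `{n, 2 * n}` on `0 < n < 2 ^ r` has at least
`2 ^ r / 3` elements. -/
lemma two_pow_div_three_le_sum (r : ℕ) (h : ℕ → ℕ)
    (hh : ∀ n, 1 ≤ n → 2 * n < 2 ^ r → 1 ≤ h (2 * n) + h n) :
    2 ^ r / 3 ≤ ∑ n ∈ Finset.range (2 ^ r), h n := by
  induction r using Nat.twoStepInduction generalizing h with
  | zero => simp
  | one => simp
  | more r ih _ =>
    have key := ih (fun n => h (4 * n)) fun n hn hlt => by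
      have := hh (4 * n) (by omega) (by rw [pow_add]; omega)
      rwa [show 2 * (4 * n) = 4 * (2 * n) by ring] at this
    have hpairs : 2 ^ r ≤ ∑ n ∈ Finset.range (2 ^ r), (h (4 * n + 2) + h (2 * n + 1)) := by
      calc 2 ^ r = ∑ n ∈ Finset.range (2 ^ r), 1 := by simp
        _ ≤ _ := Finset.sum_le_sum fun n hn => by
          have hn := Finset.mem_range.1 hn
          have := hh (2 * n + 1) (by omega) (by rw [pow_add]; omega)
          rwa [show 2 * (2 * n + 1) = 4 * n + 2 by ring] at this
    have hodd : ∑ n ∈ Finset.range (2 ^ r), h (2 * n + 1) ≤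
        ∑ n ∈ Finset.range (2 * 2 ^ r), h (2 * n + 1) :=
      Finset.sum_le_sum_of_subset (Finset.range_subset_range.2 (by omega))
    rw [Finset.sum_add_distrib] at hpairs
    rw [show 2 ^ (r + 2) = 2 * (2 * 2 ^ r) by ring, sum_range_two_mul,
      sum_range_two_mul (fun n => h (2 * n))]
    simp only [mul_add, ← mul_assoc, Nat.reduceMul, mul_one] at *
    omega

/-- The positions of the binary digits `1` of `n` below `r`. -/
def bitSet (r n : ℕ) : Finset (Fin r) :=
  Finset.univ.filter fun i => n.testBit i

lemma bitSet_injOn (r : ℕ) : Set.InjOn (bitSet r) (Finset.range (2 ^ r)) := by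
  intro m hm n hn h
  simp only [Finset.coe_range, Set.mem_Iio] at hm hn
  refine Nat.eq_of_testBit_eq fun i => ?_
  by_cases hi : i < r
  · have := congrArg ((⟨i, hi⟩ : Fin r) ∈ ·) h
    simpa [bitSet, ← Bool.eq_iff_iff] using this
  · have hp : 2 ^ r ≤ 2 ^ i := Nat.pow_le_pow_right two_pos (not_lt.1 hi)
    rw [Nat.testBit_lt_two_pow (hm.trans_le hp), Nat.testBit_lt_two_pow (hn.trans_le hp)]

lemma bitSet_two_mul (s n : ℕ) :
    bitSet (s + 1) (2 * n) = (bitSet s n).map (Fin.succEmb s) := by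
  ext i
  refine Fin.cases ?_ (fun j => ?_) i <;> simp [bitSet, Nat.testBit_succ]

lemma bitSet_succ_of_lt {s n : ℕ} (hn : n < 2 ^ s) :
    bitSet (s + 1) n = (bitSet s n).map Fin.castSuccEmb := by
  ext i
  refine Fin.lastCases ?_ (fun j => ?_) i
  · simp [bitSet, Nat.testBit_lt_two_pow hn]
  · simp [bitSet]

lemma bitSet_nonempty {s n : ℕ} (h0 : 1 ≤ n) (hn : n < 2 ^ s) : (bitSet s n).Nonempty := by
  rw [Finset.nonempty_iff_ne_empty]
  intro h
  have h0' : bitSet s 0 = ∅ := by simp [bitSet]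
  have := bitSet_injOn s (by simpa using hn) (by simp) (h.trans h0'.symm)
  omega

lemma sum_range_le_sparsity {r : ℕ} (B : (Fin r → ZMod 2) → ZMod 2) :
    ∑ n ∈ Finset.range (2 ^ r), (if anf B (bitSet r n) ≠ 0 then 1 else 0) ≤ sparsity B := by
  rw [← Finset.card_filter, sparsity]
  refine Finset.card_le_card_of_injOn (bitSet r) (fun n hn => ?_)
    ((bitSet_injOn r).mono (Finset.coe_subset.2 (Finset.filter_subset _ _)))
  simpa using (Finset.mem_filter.1 hn).2

lemma add_eq_one_of_neg_one_pow_eq_neg :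
    ∀ a b : ZMod 2, (-1 : ℤ) ^ a.val = -(-1) ^ b.val → a + b = 1 := by
  decide

theorem stmt0 (r : ℕ) (hr : 1 ≤ r) (f : ℕ → ℤ)
    (hf : ∀ n : ℕ, 1 ≤ n → f n = 1 ∨ f n = -1)
    (hf2 : ∀ n : ℕ, 1 ≤ n → n ≤ 2 ^ (r - 1) - 1 → f (2 * n) = - f n)
    (B : (Fin r → ZMod 2) → ZMod 2)
    (hB : ∀ x : Fin r → ZMod 2, x ≠ 0 → f (bitVal x) = (-1) ^ (B x).val) :
    r - 1 ≤ algDeg B ∧ 2 ^ r / 3 ≤ sparsity B := by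
  obtain ⟨s, rfl⟩ : ∃ s, r = s + 1 := ⟨r - 1, by omega⟩
  simp only [Nat.add_sub_cancel] at hf2 ⊢
  have hne : ∀ (e : Fin s ↪ Fin (s + 1)) (J : Finset (Fin s)), J.Nonempty →
      (fun i => if i ∈ J.map e then (1 : ZMod 2) else 0) ≠ 0 := by
    rintro e J ⟨j, hj⟩ h
    have := congrFun h (e j)
    simp [hj] at this
  have hflip : ∀ J : Finset (Fin s), J.Nonempty →
      B (fun i => if i ∈ J.map (Fin.succEmb s) then 1 else 0) +
        B (fun i => if i ∈ J.map Fin.castSuccEmb then 1 else 0) = 1 := by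
    intro J hJ
    apply add_eq_one_of_neg_one_pow_eq_neg
    rw [← hB _ (hne _ J hJ), ← hB _ (hne _ J hJ), bitVal_map_succ, bitVal_map_castSucc]
    exact hf2 _ (Nat.succ_le_of_lt (Finset.sum_pos (fun j _ => Nat.two_pow_pos j) hJ))
      (sum_two_pow_fin_le J)
  have hor : ∀ I : Finset (Fin s), I.Nonempty →
      anf B (I.map (Fin.succEmb s)) ≠ 0 ∨ anf B (I.map Fin.castSuccEmb) ≠ 0 := by
    intro I hI
    by_contra! h
    have := anf_map_succ_add_anf_map_castSucc B hflip hI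
    simp [h.1, h.2] at this
  constructor
  · rcases Nat.eq_zero_or_pos s with rfl | hs
    · exact Nat.zero_le _
    · have : Nonempty (Fin s) := ⟨⟨0, hs⟩⟩
      have hle : ∀ e : Fin s ↪ Fin (s + 1), anf B (Finset.univ.map e) ≠ 0 → s ≤ algDeg B := by
        intro e he
        have := Finset.le_sup (f := Finset.card)
          (show Finset.univ.map e ∈ Finset.univ.filter fun I => anf B I ≠ 0 from
            Finset.mem_filter.2 ⟨Finset.mem_univ _, he⟩)
        simpa [algDeg] using this
      exact (hor Finset.univ Finset.univ_nonempty).elim (hle _) (hle _)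
  · refine (two_pow_div_three_le_sum (s + 1)
      (fun n => if anf B (bitSet (s + 1) n) ≠ 0 then 1 else 0) fun n h1 h2 => ?_).trans
      (sum_range_le_sparsity B)
    have hn : n < 2 ^ s := by rw [pow_succ] at h2; omega
    simp only [bitSet_two_mul, bitSet_succ_of_lt hn]
    rcases hor _ (bitSet_nonempty h1 hn) with h | h <;> simp [h]
end

section
/- Let r ≥ 1 and let B : 𝔽₂^r → 𝔽₂ be the Boolean function B(X_1,…,X_r) = ∑_{∅ ≠ I ⊆ {1,…,r}, min(I) even} X^I. Then spr(B) = ⌊2^r/3⌋, and the arithmetic function f defined on {1,…,2^r - 1} by f(∑_{j=1}^r n_j 2^{j-1}) = (-1)^{B(n_1,…,n_r)} satisfies f(2n) = -f(n) for all n = 1, 2, …, 2^{r-1} - 1. In particular, the sparsity bound spr(B) ≥ ⌊2^r/3⌋ for Boolean functions representing arithmetic functions with f(2n) = -f(n) is optimal. -/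
open scoped BigOperators

/-- The Boolean function `B(X_1,…,X_r) = ∑_{∅ ≠ I ⊆ {1,…,r}, min(I) even} X^I`.
(In the `0`-based indexing of `Fin r`, the variable `X_k` of the paper corresponds to
index `k - 1`, so "`min(I)` even" becomes "the minimal element of `I` has odd value".) -/
def B2 (r : ℕ) (x : Fin r → ZMod 2) : ZMod 2 :=
  ∑ I ∈ Finset.univ.powerset.filter
      (fun I : Finset (Fin r) => ∃ j ∈ I, Odd (j : ℕ) ∧ ∀ i ∈ I, j ≤ i),
    ∏ j ∈ I, x j

/-- The sets whose minimum has odd index, summed over according to their minimum. -/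
theorem sum_filter_odd_min {M : Type*} [AddCommMonoid M] (r : ℕ) (F : Finset (Fin r) → M) :
    ∑ I ∈ Finset.univ.powerset.filter
      (fun I : Finset (Fin r) => ∃ j ∈ I, Odd (j : ℕ) ∧ ∀ i ∈ I, j ≤ i), F I =
    ∑ j ∈ Finset.univ.filter (fun j : Fin r => Odd (j : ℕ)), ∑ T ∈ (Finset.Ioi j).powerset, F (insert j T) := by
  rw [Finset.sum_sigma']
  symm
  refine Finset.sum_bij (fun p _ => insert p.1 p.2) ?_ ?_ ?_ (fun _ _ => rfl)
  · rintro ⟨j, T⟩ h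
    simp only [Finset.mem_sigma, Finset.mem_filter, Finset.mem_univ, true_and,
      Finset.mem_powerset] at h
    simp only [Finset.powerset_univ, Finset.mem_filter, Finset.mem_univ, true_and]
    refine ⟨j, Finset.mem_insert_self _ _, h.1, fun i hi => ?_⟩
    rcases Finset.mem_insert.1 hi with rfl | hi
    · exact le_rfl
    · exact (Finset.mem_Ioi.1 (h.2 hi)).le
  · rintro ⟨j, T⟩ h ⟨k, U⟩ h' heq
    simp only [Finset.mem_sigma, Finset.mem_filter, Finset.mem_univ, true_and,
      Finset.mem_powerset] at h h'
    dsimp only at heq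
    have hjT : j ∉ T := fun hj => lt_irrefl _ (Finset.mem_Ioi.1 (h.2 hj))
    have hkU : k ∉ U := fun hk => lt_irrefl _ (Finset.mem_Ioi.1 (h'.2 hk))
    have hjk : j = k := by
      apply le_antisymm
      · have hk : k ∈ insert j T := heq ▸ Finset.mem_insert_self k U
        rcases Finset.mem_insert.1 hk with hk | hk
        · exact hk.ge
        · exact (Finset.mem_Ioi.1 (h.2 hk)).le
      · have hj : j ∈ insert k U := heq ▸ Finset.mem_insert_self j T
        rcases Finset.mem_insert.1 hj with hj | hj
        · exact hj.ge
        · exact (Finset.mem_Ioi.1 (h'.2 hj)).le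
    subst hjk
    have hTU : T = U := by
      rw [← Finset.erase_insert hjT, heq, Finset.erase_insert hkU]
    rw [hTU]
  · intro I hI
    simp only [Finset.powerset_univ, Finset.mem_filter, Finset.mem_univ, true_and] at hI
    obtain ⟨j, hj, hodd, hmin⟩ := hI
    refine ⟨⟨j, I.erase j⟩, ?_, Finset.insert_erase hj⟩
    simp only [Finset.mem_sigma, Finset.mem_filter, Finset.mem_univ, true_and,
      Finset.mem_powerset]
    refine ⟨hodd, fun i hi => Finset.mem_Ioi.2 ?_⟩
    obtain ⟨hne, hi⟩ := Finset.mem_erase.1 hi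
    exact lt_of_le_of_ne (hmin i hi) hne.symm

/-- The algebraic normal form recovers the set of monomials of a polynomial. -/
theorem anf_sum_prod {r : ℕ} (S : Finset (Finset (Fin r))) (I : Finset (Fin r)) :
    anf (fun x => ∑ K ∈ S, ∏ j ∈ K, x j) I = if I ∈ S then 1 else 0 := by
  have hK (K : Finset (Fin r)) :
      ∑ J ∈ I.powerset, ∏ j ∈ K, (if j ∈ J then (1 : ZMod 2) else 0) =
        if K = I then 1 else 0 := by
    have hprod (J : Finset (Fin r)) :
        ∏ j ∈ K, (if j ∈ J then (1 : ZMod 2) else 0) = if K ⊆ J then 1 else 0 := by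
      rw [Finset.prod_ite_zero]
      simp [Finset.subset_iff]
    have hfilter : I.powerset.filter (K ⊆ ·) = Finset.Icc K I := by
      ext J
      simp [and_comm]
    simp_rw [hprod]
    rw [Finset.sum_boole, hfilter]
    by_cases hKI : K ⊆ I
    · rw [Finset.card_Icc_finset hKI]
      rcases eq_or_ne K I with rfl | hne
      · simp
      · have hlt := Finset.card_lt_card (lt_of_le_of_ne hKI hne)
        rw [if_neg hne, Nat.cast_pow, show ((2 : ℕ) : ZMod 2) = 0 from rfl,
          zero_pow (Nat.sub_ne_zero_of_lt hlt)]
    · have hne : K ≠ I := fun h => hKI h.le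
      rw [Finset.Icc_eq_empty (by simpa using hKI), if_neg hne]
      simp
  unfold anf
  rw [Finset.sum_comm]
  simp_rw [hK]
  simp

theorem sum_odd_two_pow (r : ℕ) :
    ∑ j ∈ Finset.univ.filter (fun j : Fin r => Odd (j : ℕ)), 2 ^ (r - 1 - (j : ℕ)) = 2 ^ r / 3 := by
  rw [Finset.sum_filter, Fin.sum_univ_eq_sum_range (fun j => if Odd j then 2 ^ (r - 1 - j) else 0)]
  induction r using Nat.twoStepInduction with
  | zero => simp
  | one => simp
  | more n ih _ =>
    rw [Finset.sum_range_succ', Finset.sum_range_succ']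
    have hshift : ∀ k ∈ Finset.range n,
        (if Odd (k + 1 + 1) then 2 ^ (n + 2 - 1 - (k + 1 + 1)) else 0) =
          if Odd k then 2 ^ (n - 1 - k) else 0 := by
      intro k _
      rw [show n + 2 - 1 - (k + 1 + 1) = n - 1 - k by omega]
      simp [Nat.odd_add_one]
    rw [Finset.sum_congr rfl hshift, ih]
    simp only [zero_add, odd_one, if_true, show n + 2 - 1 - 1 = n by omega, Nat.not_odd_zero,
      if_false, pow_add]
    omega

theorem sparsity_B2 (r : ℕ) : sparsity (B2 r) = 2 ^ r / 3 := by
  have hanf (I : Finset (Fin r)) := anf_sum_prod (Finset.univ.powerset.filter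
      (fun I : Finset (Fin r) => ∃ j ∈ I, Odd (j : ℕ) ∧ ∀ i ∈ I, j ≤ i)) I
  have hset : (Finset.univ.filter fun I : Finset (Fin r) => anf (B2 r) I ≠ 0) =
      Finset.univ.powerset.filter
        (fun I : Finset (Fin r) => ∃ j ∈ I, Odd (j : ℕ) ∧ ∀ i ∈ I, j ≤ i) := by
    ext I
    rw [Finset.mem_filter, show anf (B2 r) I = _ from hanf I]
    simp
  rw [sparsity, hset, Finset.card_eq_sum_ones, sum_filter_odd_min, ← sum_odd_two_pow]
  refine Finset.sum_congr rfl fun j _ => ?_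
  rw [← Finset.card_eq_sum_ones, Finset.card_powerset, Fin.card_Ioi]

/-- `B2` only depends on the parity of the largest index in the support. -/
theorem B2_eq_of_isGreatest {r : ℕ} {x : Fin r → ZMod 2} {m : Fin r} (hm : x m = 1)
    (hgt : ∀ i, m < i → x i = 0) : B2 r x = if Odd (m : ℕ) then 1 else 0 := by
  have hterm (j : Fin r) : ∑ T ∈ (Finset.Ioi j).powerset, ∏ i ∈ insert j T, x i =
      if j = m then 1 else 0 := by
    have hfactor : ∑ T ∈ (Finset.Ioi j).powerset, ∏ i ∈ insert j T, x i =
        x j * ∏ i ∈ Finset.Ioi j, (1 + x i) := by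
      rw [Finset.prod_one_add, Finset.mul_sum]
      refine Finset.sum_congr rfl fun T hT => Finset.prod_insert fun hj => ?_
      exact lt_irrefl _ (Finset.mem_Ioi.1 (Finset.mem_powerset.1 hT hj))
    rw [hfactor]
    rcases lt_trichotomy j m with h | rfl | h
    · rw [if_neg h.ne, Finset.prod_eq_zero (Finset.mem_Ioi.2 h), mul_zero]
      rw [hm]
      rfl
    · rw [if_pos rfl, hm, one_mul]
      refine Finset.prod_eq_one fun i hi => ?_
      rw [hgt i (Finset.mem_Ioi.1 hi), add_zero]
    · rw [if_neg h.ne', hgt j h, zero_mul]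
  rw [B2, sum_filter_odd_min]
  simp_rw [hterm]
  simp

theorem bitVal_testBit (r n : ℕ) (hn : n < 2 ^ r) :
    bitVal (fun i : Fin r => if n.testBit i then 1 else 0) = n := by
  induction r generalizing n with
  | zero => simp_all [bitVal]
  | succ r ih =>
    have hhalf := ih (n / 2) (by rw [pow_succ] at hn; omega)
    unfold bitVal at hhalf ⊢
    rw [Fin.sum_univ_succ]
    have hshift : ∀ i : Fin r,
        (if n.testBit (i.succ : ℕ) then (1 : ZMod 2) else 0).val * 2 ^ (i.succ : ℕ) =
          2 * ((if (n / 2).testBit i then (1 : ZMod 2) else 0).val * 2 ^ (i : ℕ)) := by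
      intro i
      rw [Fin.val_succ, Nat.testBit_succ, pow_succ]
      ring
    rw [Finset.sum_congr rfl fun i _ => hshift i, ← Finset.mul_sum, hhalf]
    rcases Nat.mod_two_eq_zero_or_one n with h | h
    · simp [Nat.testBit_zero, h]
      omega
    · simp [Nat.testBit_zero, h, ZMod.val_one]
      omega

/-- A function represented by `B2` is `(-1)` to the index of the leading binary digit. -/
theorem eq_neg_one_pow_log {r : ℕ} {f : ℕ → ℤ}
    (hf : ∀ x : Fin r → ZMod 2, x ≠ 0 → f (bitVal x) = (-1) ^ (B2 r x).val)
    {n : ℕ} (hn : n ≠ 0) (hlt : n < 2 ^ r) : f n = (-1) ^ Nat.log 2 n := by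
  have hlog : Nat.log 2 n < r := Nat.log_lt_of_lt_pow hn hlt
  let x : Fin r → ZMod 2 := fun i => if n.testBit i then 1 else 0
  have hm : x ⟨Nat.log 2 n, hlog⟩ = 1 := by
    simp [x, ← Nat.log2_eq_log_two, Nat.testBit_log2 hn]
  have hgt (i : Fin r) (hi : ⟨Nat.log 2 n, hlog⟩ < i) : x i = 0 := by
    have h : n.testBit i = false :=
      Nat.testBit_lt_two_pow (Nat.lt_pow_of_log_lt one_lt_two (Fin.lt_def.1 hi))
    simp [x, h]
  have hx : x ≠ 0 := fun h => by simp [h] at hm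
  have hfx := hf x hx
  rw [bitVal_testBit r n hlt, B2_eq_of_isGreatest hm hgt] at hfx
  rw [hfx]
  rcases Nat.even_or_odd (Nat.log 2 n) with h | h
  · simp [h, Nat.not_odd_iff_even.2 h]
  · simp [h, ZMod.val_one]

theorem stmt2 (r : ℕ) (hr : 1 ≤ r) :
    sparsity (B2 r) = 2 ^ r / 3 ∧
      ∀ f : ℕ → ℤ,
        (∀ x : Fin r → ZMod 2, x ≠ 0 → f (bitVal x) = (-1) ^ (B2 r x).val) →
        ∀ n : ℕ, 1 ≤ n → n ≤ 2 ^ (r - 1) - 1 → f (2 * n) = - f n := by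
  refine ⟨sparsity_B2 r, fun f hf n h1 hn => ?_⟩
  have hpow : 2 ^ r = 2 * 2 ^ (r - 1) := by rw [← pow_succ', Nat.sub_add_cancel hr]
  have hpos : 0 < 2 ^ (r - 1) := by positivity
  rw [eq_neg_one_pow_log hf (n := 2 * n) (by omega) (by omega),
    eq_neg_one_pow_log hf (n := n) (by omega) (by omega), mul_comm,
    Nat.log_mul_base one_lt_two (by omega), pow_succ, mul_neg_one]
end

section
/- Let p be a prime with p ≡ 1 (mod 8) or p ≡ 7 (mod 8) (equivalently p ≡ ±1 mod 8) and p > 7, let N(p) denote the least quadratic non-residue modulo p (note N(p) > 2), and put r = ⌊log₂ p⌋ and s = ⌈log₂ N(p)⌉. Let B : 𝔽₂^r → 𝔽₂ be any Boolean function satisfying (∑_{j=1}^r n_j 2^{j-1} / p) = (-1)^{B(n_1,…,n_r)} for all (n_1,…,n_r) ∈ 𝔽₂^r \ {(0,…,0)}, where (·/p) is the Legendre symbol. Then deg(B) ≥ ⌊r/s⌋ and spr(B) ≥ 2^{⌊r/s⌋ - 1}. -/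
open scoped BigOperators

/-- The indicator vector of a set of coordinates. -/
def indVec {r : ℕ} (J : Finset (Fin r)) : Fin r → ZMod 2 := fun i => if i ∈ J then 1 else 0

/-- The number of sets between `s` and `t` is odd exactly when `s = t`. -/
lemma card_between_cast {α : Type*} [DecidableEq α] (s t : Finset α) :
    ((t.powerset.filter fun u => s ⊆ u).card : ZMod 2) = if s = t then 1 else 0 := by
  have h : (t.powerset.filter fun u => s ⊆ u) = Finset.Icc s t := by
    ext u
    simp [and_comm]
  rw [h]
  by_cases hst : s ⊆ t
  · rw [Finset.card_Icc_finset hst]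
    split_ifs with he
    · simp [he]
    · have hlt := Finset.card_lt_card (Finset.ssubset_iff_subset_ne.2 ⟨hst, he⟩)
      have h2 : (2 : ZMod 2) = 0 := rfl
      push_cast
      rw [h2, zero_pow (by omega)]
  · rw [Finset.Icc_eq_empty hst, if_neg (fun h => hst h.subset)]
    simp

/-- Möbius inversion over `𝔽₂`: a Boolean function is the sum of its monomials. -/
lemma eq_sum_anf {r : ℕ} (B : (Fin r → ZMod 2) → ZMod 2) (J : Finset (Fin r)) :
    B (indVec J) = ∑ I ∈ J.powerset, anf B I := by
  have h : ∀ I ∈ J.powerset, anf B I =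
      ∑ K ∈ J.powerset, if K ⊆ I then B (indVec K) else 0 := by
    intro I hI
    rw [← Finset.sum_filter]
    refine Finset.sum_congr ?_ fun _ _ => rfl
    ext K
    simp only [Finset.mem_powerset, Finset.mem_filter] at hI ⊢
    exact ⟨fun hK => ⟨hK.trans hI, hK⟩, fun hK => hK.2⟩
  rw [Finset.sum_congr rfl h, Finset.sum_comm]
  have h' : ∀ K ∈ J.powerset, (∑ I ∈ J.powerset, if K ⊆ I then B (indVec K) else 0) =
      if K = J then B (indVec K) else 0 := by
    intro K _
    rw [← Finset.sum_filter, Finset.sum_const, nsmul_eq_mul, card_between_cast]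
    simp
  rw [Finset.sum_congr rfl h']
  simp

/-- Identifying variables along `b` and setting those outside `T` to `0` sends monomials to
monomials: the coefficient at `V` is the sum of the coefficients of the monomials over `V`. -/
lemma sum_powerset_subst {r : ℕ} (B : (Fin r → ZMod 2) → ZMod 2) (T : Finset (Fin r))
    (b : Fin r → ℕ) (V : Finset ℕ) :
    ∑ U ∈ V.powerset, B (indVec (T.filter fun j => b j ∈ U)) =
      ∑ I ∈ T.powerset, if I.image b = V then anf B I else 0 := by
  have h : ∀ U ∈ V.powerset, B (indVec (T.filter fun j => b j ∈ U)) =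
      ∑ I ∈ T.powerset, if I.image b ⊆ U then anf B I else 0 := by
    intro U _
    rw [eq_sum_anf B, ← Finset.sum_filter]
    refine Finset.sum_congr ?_ fun _ _ => rfl
    ext I
    simp only [Finset.mem_powerset, Finset.mem_filter, Finset.image_subset_iff]
    constructor
    · intro hI
      exact ⟨fun x hx => (Finset.mem_filter.1 (hI hx)).1,
        fun x hx => (Finset.mem_filter.1 (hI hx)).2⟩
    · rintro ⟨h1, h2⟩ x hx
      exact Finset.mem_filter.2 ⟨h1 hx, h2 x hx⟩
  rw [Finset.sum_congr rfl h, Finset.sum_comm]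
  refine Finset.sum_congr rfl fun I _ => ?_
  rw [← Finset.sum_filter, Finset.sum_const, nsmul_eq_mul, card_between_cast]
  simp

lemma exists_anf_ne_zero_of_subst {r : ℕ} {B : (Fin r → ZMod 2) → ZMod 2} {T : Finset (Fin r)}
    {b : Fin r → ℕ} {V : Finset ℕ}
    (h : ∑ U ∈ V.powerset, B (indVec (T.filter fun j => b j ∈ U)) ≠ 0) :
    ∃ I, anf B I ≠ 0 ∧ I.image b = V := by
  rw [sum_powerset_subst] at h
  obtain ⟨I, _, hI⟩ := Finset.exists_ne_zero_of_sum_ne_zero h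
  by_cases hV : I.image b = V
  · rw [if_pos hV] at hI
    exact ⟨I, hI, hV⟩
  · simp [hV] at hI

/-- If two substitutions into `B` differ by `1` away from the origin and agree there, then every
nonempty set of `V` variables is hit by a monomial of `B`. -/
lemma exists_anf_ne_zero {r : ℕ} {B : (Fin r → ZMod 2) → ZMod 2} {T T' : Finset (Fin r)}
    {b : Fin r → ℕ} {V : Finset ℕ} (hV : V.Nonempty)
    (h : ∀ U ⊆ V, U.Nonempty → B (indVec (T.filter fun j => b j ∈ U)) +
      B (indVec (T'.filter fun j => b j ∈ U)) = 1) :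
    ∃ I, anf B I ≠ 0 ∧ I.image b = V := by
  by_contra hcon
  have h1 : ∑ U ∈ V.powerset, B (indVec (T.filter fun j => b j ∈ U)) = 0 :=
    of_not_not fun h => hcon (exists_anf_ne_zero_of_subst h)
  have h2 : ∑ U ∈ V.powerset, B (indVec (T'.filter fun j => b j ∈ U)) = 0 :=
    of_not_not fun h => hcon (exists_anf_ne_zero_of_subst h)
  have h3 : ∑ U ∈ V.powerset, (B (indVec (T.filter fun j => b j ∈ U)) +
      B (indVec (T'.filter fun j => b j ∈ U))) = ∑ U ∈ V.powerset,
      ((1 : ZMod 2) + if U = ∅ then 1 else 0) := by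
    refine Finset.sum_congr rfl fun U hU => ?_
    rcases U.eq_empty_or_nonempty with rfl | hne
    · simp only [Finset.notMem_empty, Finset.filter_false, if_true]
      rw [CharTwo.add_self_eq_zero, CharTwo.add_self_eq_zero]
    · rw [h U (Finset.mem_powerset.1 hU) hne, if_neg hne.ne_empty, add_zero]
  rw [Finset.sum_add_distrib, h1, h2, Finset.sum_add_distrib] at h3
  have h4 : (2 : ZMod 2) = 0 := rfl
  simp [h4, hV.card_pos.ne'] at h3

/-- The positions `j` for which the `j % s`-th binary digit of `c` is `1`. -/
def digitSet (r s c : ℕ) : Finset (Fin r) :=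
  Finset.univ.filter fun j => c.testBit ((j : ℕ) % s) = true

lemma sum_testBit_two_pow (c s : ℕ) :
    (∑ t ∈ Finset.range s, if c.testBit t = true then 2 ^ t else 0) = c % 2 ^ s := by
  induction s with
  | zero => simp [Nat.mod_one]
  | succ s ih =>
    rw [Finset.sum_range_succ, ih, Nat.mod_pow_succ, ← Nat.toNat_testBit]
    cases c.testBit s <;> simp

lemma bitVal_indVec {r : ℕ} (J : Finset (Fin r)) :
    bitVal (indVec J) = ∑ j ∈ J, 2 ^ (j : ℕ) := by
  have h : ∀ j, (indVec J j).val * 2 ^ (j : ℕ) = if j ∈ J then 2 ^ (j : ℕ) else 0 := by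
    intro j
    unfold indVec
    split_ifs
    · rw [show ((1 : ZMod 2).val) = 1 from rfl, one_mul]
    · simp
  simp only [bitVal, h]
  simp

/-- Writing the digits of `c` into the blocks in `U` gives `c * ∑ i ∈ U, 2 ^ (s * i)`. -/
lemma bitVal_digitSet {r s c : ℕ} (hs : 0 < s) (hc : c < 2 ^ s) {U : Finset ℕ}
    (hU : U ⊆ Finset.range (r / s)) :
    bitVal (indVec ((digitSet r s c).filter fun j => (j : ℕ) / s ∈ U)) =
      c * ∑ i ∈ U, 2 ^ (s * i) := by
  rw [bitVal_indVec, ← Finset.sum_fiberwise_of_maps_to (t := U) (g := fun j : Fin r => (j : ℕ) / s)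
    (fun j hj => (Finset.mem_filter.1 hj).2), Finset.mul_sum]
  refine Finset.sum_congr rfl fun i hi => ?_
  have hir : s * (i + 1) ≤ r :=
    (Nat.mul_le_mul_left s (Finset.mem_range.1 (hU hi))).trans (Nat.mul_div_le r s)
  have hlt : ∀ t, t < s → s * i + t < r := fun t ht => by
    rw [mul_add] at hir
    omega
  conv_rhs => rw [← Nat.mod_eq_of_lt hc, ← sum_testBit_two_pow, ← Finset.sum_filter,
    Finset.sum_mul]
  refine Finset.sum_bij' (fun j _ => (j : ℕ) % s)
    (fun t ht => ⟨s * i + t, hlt t (Finset.mem_range.1 (Finset.mem_filter.1 ht).1)⟩) ?_ ?_ ?_ ?_ ?_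
  · intro j hj
    simp only [digitSet, Finset.mem_filter, Finset.mem_univ, true_and] at hj
    exact Finset.mem_filter.2 ⟨Finset.mem_range.2 (Nat.mod_lt _ hs), hj.1.1⟩
  · intro t ht
    simp only [Finset.mem_filter, Finset.mem_range] at ht
    have h1 : (s * i + t) / s = i := by
      rw [Nat.mul_add_div hs, Nat.div_eq_of_lt ht.1, add_zero]
    have h2 : (s * i + t) % s = t := by
      rw [Nat.mul_add_mod, Nat.mod_eq_of_lt ht.1]
    simp [digitSet, h1, h2, hi, ht.2]
  · intro j hj
    have h := (Finset.mem_filter.1 hj).2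
    apply Fin.ext
    simp only [← h]
    exact Nat.div_add_mod _ _
  · intro t ht
    simp only [Finset.mem_filter, Finset.mem_range] at ht
    simp only [Nat.mul_add_mod, Nat.mod_eq_of_lt ht.1]
  · intro j hj
    have h := (Finset.mem_filter.1 hj).2
    rw [← pow_add, ← h, Nat.mod_add_div]

lemma legendreSym_two_eq_one {p : ℕ} [Fact p.Prime] (hp : p % 8 = 1 ∨ p % 8 = 7) :
    legendreSym p 2 = 1 := by
  have hp2 : p ≠ 2 := by
    rintro rfl
    omega
  have hp2' : (((2 : ℤ)) : ZMod p) ≠ 0 := by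
    intro h
    have h' : ((2 : ℕ) : ZMod p) = 0 := by exact_mod_cast h
    rw [ZMod.natCast_eq_zero_iff] at h'
    exact hp2 ((Nat.prime_dvd_prime_iff_eq Fact.out Nat.prime_two).1 h')
  rw [legendreSym.eq_one_iff p hp2']
  have h := (ZMod.exists_sq_eq_two_iff hp2).2 hp
  exact_mod_cast h

/-- If `2` is a quadratic residue, the least non-residue is less than half of `p`. -/
lemma two_mul_least_nonresidue_lt {p : ℕ} [Fact p.Prime] (h2 : legendreSym p 2 = 1) {q : ℕ}
    (hq : IsLeast {n : ℕ | 0 < n ∧ legendreSym p n = -1} q) : 2 * q < p := by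
  obtain ⟨⟨hq0, hqn⟩, hmin⟩ := hq
  have hp0 : 0 < p := (Fact.out : p.Prime).pos
  have hcast : ∀ a : ℕ, legendreSym p ((a % p : ℕ) : ℤ) = legendreSym p (a : ℤ) := by
    intro a
    rw [Int.natCast_mod, ← legendreSym.mod]
  have hne0 : ∀ a : ℕ, legendreSym p (a : ℤ) = -1 → 0 < a % p := by
    intro a ha
    rw [Nat.pos_iff_ne_zero]
    intro h
    have := hcast a
    rw [h, ha] at this
    simp at this
  have hqp : q < p := (hmin ⟨hne0 q hqn, by rw [hcast, hqn]⟩).trans_lt (Nat.mod_lt _ hp0)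
  have h2q : legendreSym p ((2 * q : ℕ) : ℤ) = -1 := by
    push_cast
    rw [legendreSym.mul, h2, hqn, one_mul]
  have hle : q ≤ 2 * q % p := hmin ⟨hne0 _ h2q, by rw [hcast, h2q]⟩
  by_contra hcon
  rw [Nat.mod_eq_sub_mod (by omega), Nat.mod_eq_of_lt (by omega)] at hle
  omega

theorem stmt4 (p : ℕ) [Fact p.Prime] (hp : p % 8 = 1 ∨ p % 8 = 7) (hp7 : 7 < p)
    (q : ℕ) (hq : IsLeast {n : ℕ | 0 < n ∧ legendreSym p n = -1} q)
    (r s : ℕ) (hr : r = Nat.log 2 p) (hs : s = Nat.clog 2 q)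
    (B : (Fin r → ZMod 2) → ZMod 2)
    (hB : ∀ x : Fin r → ZMod 2, x ≠ 0 →
      legendreSym p (bitVal x) = (-1) ^ (B x).val) :
    r / s ≤ algDeg B ∧ 2 ^ (r / s - 1) ≤ sparsity B := by
  subst hs
  set s := Nat.clog 2 q with hs
  have h2 := legendreSym_two_eq_one hp
  have hlt := two_mul_least_nonresidue_lt h2 hq
  have hqn : legendreSym p q = -1 := hq.1.2
  have hq1 : 1 < q := by
    refine lt_of_le_of_ne hq.1.1 fun h => ?_
    rw [← h] at hqn
    simp at hqn
  have hs0 : 0 < s := Nat.clog_pos one_lt_two hq1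
  have hqs : q < 2 ^ s := by
    refine lt_of_le_of_ne (Nat.le_pow_clog one_lt_two q) fun h => ?_
    rw [h] at hqn
    have h1 : ∀ n : ℕ, legendreSym p ((2 ^ n : ℕ) : ℤ) = 1 := by
      intro n
      induction n with
      | zero => simp
      | succ n ih =>
        rw [pow_succ, Nat.cast_mul, legendreSym.mul, ih, one_mul]
        exact h2
    rw [h1] at hqn
    norm_num at hqn
  have hsr : s ≤ r := by
    refine Nat.clog_le_of_le_pow ?_
    have := Nat.lt_pow_succ_log_self one_lt_two p
    rw [← hr, pow_succ] at this
    omega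
  have hk : 0 < r / s := Nat.div_pos hsr hs0
  have key : ∀ V ⊆ Finset.range (r / s), V.Nonempty →
      ∃ I, anf B I ≠ 0 ∧ I.image (fun j : Fin r => (j : ℕ) / s) = V := by
    intro V hVk hV
    refine exists_anf_ne_zero (T := digitSet r s q) (T' := digitSet r s 1) hV fun U hUV hU => ?_
    have hUk := hUV.trans hVk
    have hm : 0 < ∑ i ∈ U, 2 ^ (s * i) := Finset.sum_pos (fun _ _ => by positivity) hU
    have hval : ∀ c, 0 < c → c < 2 ^ s →
        legendreSym p ((c * ∑ i ∈ U, 2 ^ (s * i) : ℕ) : ℤ) =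
          (-1) ^ (B (indVec ((digitSet r s c).filter fun j => (j : ℕ) / s ∈ U))).val := by
      intro c hc0 hc
      have hb := bitVal_digitSet hs0 hc hUk
      rw [← hb]
      refine hB _ fun h0 => ?_
      rw [h0] at hb
      simp only [bitVal, Pi.zero_apply, ZMod.val_zero, zero_mul, Finset.sum_const_zero] at hb
      exact (Nat.mul_pos hc0 hm).ne hb
    have e1 := hval q hq.1.1 hqs
    have e2 := hval 1 one_pos (hq1.trans hqs)
    rw [one_mul] at e2
    rw [Nat.cast_mul, legendreSym.mul, hqn, e2] at e1
    generalize B (indVec ((digitSet r s q).filter fun j => (j : ℕ) / s ∈ U)) = x at e1 ⊢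
    generalize B (indVec ((digitSet r s 1).filter fun j => (j : ℕ) / s ∈ U)) = y at e1 ⊢
    revert x y
    decide
  constructor
  · obtain ⟨I, hI, hIV⟩ := key _ subset_rfl (Finset.nonempty_range_iff.2 hk.ne')
    have h1 : r / s ≤ I.card := by
      have := Finset.card_image_le (s := I) (f := fun j : Fin r => (j : ℕ) / s)
      rwa [hIV, Finset.card_range] at this
    exact h1.trans (Finset.le_sup (f := Finset.card) (by simpa using hI))
  · have hsub : (Finset.range (r / s)).powerset.erase ∅ ⊆
        (Finset.univ.filter fun I : Finset (Fin r) => anf B I ≠ 0).image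
          fun I => I.image fun j : Fin r => (j : ℕ) / s := by
      intro V hV
      rw [Finset.mem_erase, Finset.mem_powerset] at hV
      obtain ⟨I, hI, hIV⟩ := key V hV.2 (Finset.nonempty_iff_ne_empty.2 hV.1)
      exact Finset.mem_image.2 ⟨I, by simpa using hI, hIV⟩
    have hcard := (Finset.card_le_card hsub).trans Finset.card_image_le
    rw [Finset.card_erase_of_mem (Finset.empty_mem_powerset _), Finset.card_powerset,
      Finset.card_range] at hcard
    obtain ⟨k, hk'⟩ : ∃ k, r / s = k + 1 := ⟨r / s - 1, by omega⟩
    rw [hk', pow_succ] at hcard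
    rw [hk', Nat.add_sub_cancel]
    have hpos : 0 < 2 ^ k := by positivity
    change _ ≤ sparsity B at hcard
    omega
end

section
/- The integer Liouville function satisfies λ(2n) = -λ(n) for all n ≥ 1. Consequently, for every r ≥ 1, any Boolean function B : 𝔽₂^r → 𝔽₂ satisfying λ(∑_{j=1}^r n_j 2^{j-1}) = (-1)^{B(n_1,…,n_r)} for all (n_1,…,n_r) ∈ 𝔽₂^r \ {(0,…,0)} satisfies deg(B) ≥ r - 1 and spr(B) ≥ ⌊2^r/3⌋. -/
open scoped BigOperators

/-- The Liouville function `λ(n) = (-1)^{Ω(n)}`, where `Ω(n)` is the number of prime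
factors of `n` counted with multiplicity. -/
def liouville (n : ℕ) : ℤ := (-1) ^ (ArithmeticFunction.cardFactors n)

/-- A sequence in `ZMod 2` that flips under doubling has many nonzero values below `2 ^ r`. -/
theorem two_pow_div_three_le_card_ne_zero (c : ℕ → ZMod 2) (r : ℕ)
    (hc : ∀ n, 1 ≤ n → 2 * n < 2 ^ r → c (2 * n) = c n + 1) :
    2 ^ r / 3 ≤ ((Finset.Ico 1 (2 ^ r)).filter fun n => c n ≠ 0).card := by
  induction r using Nat.twoStepInduction with
  | zero => simp
  | one => simp
  | more r ih _ =>
    have hpos : 1 ≤ 2 ^ r := Nat.one_le_two_pow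
    have hpow : 2 ^ (r + 2) = 4 * 2 ^ r := by ring
    rw [hpow] at hc ⊢
    specialize ih fun n h1 h2 => hc n h1 (by omega)
    have hpair : 2 ^ r ≤
        ((Finset.Ico (2 ^ r) (4 * 2 ^ r)).filter fun n => c n ≠ 0).card := by
      calc 2 ^ r = (Finset.Ico (2 ^ r) (2 * 2 ^ r)).card := by rw [Nat.card_Ico]; omega
        _ ≤ _ := by
          refine Finset.card_le_card_of_injOn (fun n => if c n ≠ 0 then n else 2 * n) ?_ ?_
          · intro n hn
            simp only [Finset.coe_Ico, Set.mem_Ico] at hn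
            have := hc n (by omega) (by omega)
            by_cases h : c n = 0
            · simp [h, this]; omega
            · simp [h]; omega
          · intro m hm n hn h
            simp only [Finset.coe_Ico, Set.mem_Ico] at hm hn
            dsimp only at h
            split_ifs at h <;> omega
    have hdisj : Disjoint ((Finset.Ico 1 (2 ^ r)).filter fun n => c n ≠ 0)
        ((Finset.Ico (2 ^ r) (4 * 2 ^ r)).filter fun n => c n ≠ 0) :=
      Finset.disjoint_filter_filter (Finset.Ico_disjoint_Ico_consecutive _ _ _)
    rw [← Finset.Ico_union_Ico_eq_Ico hpos (by omega : 2 ^ r ≤ 4 * 2 ^ r), Finset.filter_union,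
      Finset.card_union_of_disjoint hdisj]
    omega

theorem liouville_two_mul {n : ℕ} (hn : 1 ≤ n) : liouville (2 * n) = -liouville n := by
  rw [liouville, liouville, ArithmeticFunction.cardFactors_mul two_ne_zero (by omega),
    ArithmeticFunction.cardFactors_apply_prime Nat.prime_two, pow_add]
  ring

/-- The indicator vector of the elements of `S` below `r`. -/
def bitVec (r : ℕ) (S : Finset ℕ) : Fin r → ZMod 2 := fun i => if (i : ℕ) ∈ S then 1 else 0

/-- The algebraic normal form coefficient of `B` indexed by a finite set of naturals. -/
def natAnf {r : ℕ} (B : (Fin r → ZMod 2) → ZMod 2) (S : Finset ℕ) : ZMod 2 :=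
  ∑ J ∈ S.powerset, B (bitVec r J)

theorem sum_powerset_map {α β M : Type*} [AddCommMonoid M] (e : α ↪ β) (S : Finset α)
    (f : Finset β → M) :
    ∑ J ∈ (S.map e).powerset, f J = ∑ J ∈ S.powerset, f (J.map e) := by
  refine (Finset.sum_bij (fun J _ => J.map e) ?_ ?_ ?_ ?_).symm
  · intro J hJ
    simpa using hJ
  · intro J _ K _ h
    exact Finset.map_injective e h
  · intro K hK
    obtain ⟨J, hJ, rfl⟩ := Finset.subset_map_iff.mp (Finset.mem_powerset.mp hK)
    exact ⟨J, Finset.mem_powerset.mpr hJ, rfl⟩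
  · intros; rfl

theorem natAnf_map_val {r : ℕ} (B : (Fin r → ZMod 2) → ZMod 2) (I : Finset (Fin r)) :
    natAnf B (I.map Fin.valEmbedding) = anf B I := by
  rw [natAnf, anf, sum_powerset_map]
  refine Finset.sum_congr rfl fun J _ => congrArg B ?_
  ext i
  simp [bitVec, Fin.val_inj]

theorem map_val_filter_mem {r : ℕ} {S : Finset ℕ} (hS : ∀ i ∈ S, i < r) :
    (Finset.univ.filter fun i : Fin r => (i : ℕ) ∈ S).map Fin.valEmbedding = S := by
  ext i
  simp only [Finset.mem_map, Finset.mem_filter, Finset.mem_univ, true_and,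
    Fin.valEmbedding_apply]
  exact ⟨fun ⟨j, hj, h⟩ => h ▸ hj, fun h => ⟨⟨i, hS i h⟩, h, rfl⟩⟩

theorem bitVal_bitVec {r : ℕ} {S : Finset ℕ} (hS : ∀ i ∈ S, i < r) :
    bitVal (bitVec r S) = ∑ i ∈ S, 2 ^ i := by
  conv_rhs => rw [← map_val_filter_mem hS, Finset.sum_map, Finset.sum_filter]
  refine Finset.sum_congr rfl fun i _ => ?_
  by_cases h : (i : ℕ) ∈ S <;> simp [bitVec, h, ZMod.val_one]

theorem bitVec_ne_zero {r : ℕ} {S : Finset ℕ} (hS : ∀ i ∈ S, i < r) (hne : S.Nonempty) :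
    bitVec r S ≠ 0 := by
  obtain ⟨i, hi⟩ := hne
  intro h
  simpa [bitVec, hi] using congrFun h ⟨i, hS i hi⟩

/-- The embedding `i ↦ i + 1` of the naturals. -/
def succEmb : ℕ ↪ ℕ := ⟨Nat.succ, Nat.succ_injective⟩

theorem sum_two_pow_map_succ (S : Finset ℕ) :
    ∑ i ∈ S.map succEmb, 2 ^ i = 2 * ∑ i ∈ S, 2 ^ i := by
  simp [succEmb, Finset.mul_sum, pow_succ, mul_comm]

theorem eq_add_one_of_neg_one_pow_val :
    ∀ a b : ZMod 2, (-1 : ℤ) ^ a.val = -(-1) ^ b.val → a = b + 1 := by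
  decide

theorem apply_bitVec_map_succ {r : ℕ} {B : (Fin r → ZMod 2) → ZMod 2}
    (hB : ∀ x : Fin r → ZMod 2, x ≠ 0 → liouville (bitVal x) = (-1) ^ (B x).val)
    {S : Finset ℕ} (hS : ∀ i ∈ S, i + 1 < r)
    (hne : S.Nonempty) :
    B (bitVec r (S.map succEmb)) = B (bitVec r S) + 1 := by
  have hS' : ∀ i ∈ S, i < r := fun i hi => (Nat.lt_succ_self i).trans (hS i hi)
  have hT : ∀ i ∈ S.map succEmb, i < r := by
    intro i hi
    obtain ⟨j, hj, rfl⟩ := Finset.mem_map.mp hi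
    exact hS j hj
  apply eq_add_one_of_neg_one_pow_val
  rw [← hB _ (bitVec_ne_zero hT (hne.map)), ← hB _ (bitVec_ne_zero hS' hne), bitVal_bitVec hT,
    bitVal_bitVec hS', sum_two_pow_map_succ, liouville_two_mul]
  exact Nat.succ_le_of_lt (Finset.sum_pos (fun i _ => Nat.two_pow_pos i) hne)

theorem natAnf_map_succ {r : ℕ} {B : (Fin r → ZMod 2) → ZMod 2}
    (hB : ∀ x : Fin r → ZMod 2, x ≠ 0 → liouville (bitVal x) = (-1) ^ (B x).val)
    {S : Finset ℕ} (hS : ∀ i ∈ S, i + 1 < r) (hne : S.Nonempty) :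
    natAnf B (S.map succEmb) = natAnf B S + 1 := by
  have hmem : ∅ ∈ S.powerset := Finset.empty_mem_powerset S
  have hsum : ∑ J ∈ S.powerset.erase ∅, B (bitVec r (J.map succEmb)) =
      ∑ J ∈ S.powerset.erase ∅, B (bitVec r J) + 1 := by
    have hcard : ((S.powerset.erase ∅).card : ZMod 2) = 1 := by
      rw [Finset.card_erase_of_mem hmem, Finset.card_powerset,
        Nat.cast_sub Nat.one_le_two_pow, Nat.cast_pow, Nat.cast_ofNat,
        show (2 : ZMod 2) = 0 from rfl, zero_pow hne.card_pos.ne']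
      rfl
    rw [← hcard, Finset.cast_card, ← Finset.sum_add_distrib]
    refine Finset.sum_congr rfl fun J hJ => ?_
    rw [Finset.mem_erase, Finset.mem_powerset] at hJ
    exact apply_bitVec_map_succ hB (fun i hi => hS i (hJ.2 hi))
      (Finset.nonempty_iff_ne_empty.mpr hJ.1)
  rw [natAnf, natAnf, sum_powerset_map, ← Finset.add_sum_erase _ _ hmem,
    ← Finset.add_sum_erase S.powerset _ hmem, hsum, Finset.map_empty, add_assoc]

theorem card_le_algDeg {r : ℕ} {B : (Fin r → ZMod 2) → ZMod 2} {S : Finset ℕ}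
    (hS : ∀ i ∈ S, i < r) (h : natAnf B S ≠ 0) : S.card ≤ algDeg B := by
  rw [← map_val_filter_mem hS] at h ⊢
  rw [natAnf_map_val] at h
  rw [Finset.card_map]
  exact Finset.le_sup (f := Finset.card) (Finset.mem_filter.mpr ⟨Finset.mem_univ _, h⟩)

theorem lt_of_mem_equivBitIndices {n r i : ℕ} (hn : n < 2 ^ r)
    (hi : i ∈ Finset.equivBitIndices n) : i < r := by
  have : i ∈ n.bitIndices := by simpa using hi
  exact (Nat.pow_lt_pow_iff_right one_lt_two).mp
    ((Nat.two_pow_le_of_mem_bitIndices this).trans_lt hn)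

theorem equivBitIndices_two_mul (n : ℕ) :
    Finset.equivBitIndices (2 * n) = (Finset.equivBitIndices n).map succEmb := by
  rw [← Equiv.eq_symm_apply]
  have h : ∀ S, Finset.equivBitIndices.symm S = ∑ i ∈ S, 2 ^ i := fun _ => rfl
  rw [h, sum_two_pow_map_succ, ← h, Equiv.symm_apply_apply]

theorem card_natAnf_ne_zero_le_sparsity {r : ℕ} (B : (Fin r → ZMod 2) → ZMod 2) :
    ((Finset.Ico 1 (2 ^ r)).filter fun n => natAnf B (Finset.equivBitIndices n) ≠ 0).card ≤
      sparsity B := by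
  have key : ∀ n < 2 ^ r, (Finset.univ.filter fun i : Fin r =>
      (i : ℕ) ∈ Finset.equivBitIndices n).map Fin.valEmbedding = Finset.equivBitIndices n :=
    fun n hn => map_val_filter_mem fun i hi => lt_of_mem_equivBitIndices hn hi
  refine Finset.card_le_card_of_injOn
    (fun n => Finset.univ.filter fun i : Fin r => (i : ℕ) ∈ Finset.equivBitIndices n) ?_ ?_
  · intro n hn
    rw [Finset.mem_coe, Finset.mem_filter, Finset.mem_Ico] at hn
    rw [Finset.mem_coe, Finset.mem_filter, ← natAnf_map_val, key n hn.1.2]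
    exact ⟨Finset.mem_univ _, hn.2⟩
  · intro m hm n hn h
    rw [Finset.mem_coe, Finset.mem_filter, Finset.mem_Ico] at hm hn
    apply Finset.equivBitIndices.injective
    rw [← key m hm.1.2, ← key n hn.1.2]
    exact congrArg _ h

theorem stmt5 :
    (∀ n : ℕ, 1 ≤ n → liouville (2 * n) = - liouville n) ∧
      ∀ r : ℕ, 1 ≤ r → ∀ B : (Fin r → ZMod 2) → ZMod 2,
        (∀ x : Fin r → ZMod 2, x ≠ 0 → liouville (bitVal x) = (-1) ^ (B x).val) →
        r - 1 ≤ algDeg B ∧ 2 ^ r / 3 ≤ sparsity B := by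
  refine ⟨fun n hn => liouville_two_mul hn, fun r _ B hB => ⟨?_, ?_⟩⟩
  · rcases Nat.eq_zero_or_pos (r - 1) with h0 | hpos
    · omega
    have hS : ∀ i ∈ Finset.range (r - 1), i + 1 < r := by
      intro i hi
      rw [Finset.mem_range] at hi
      omega
    have hshift := natAnf_map_succ hB hS (Finset.nonempty_range_iff.mpr hpos.ne')
    by_cases h : natAnf B (Finset.range (r - 1)) = 0
    · rw [h, zero_add] at hshift
      have hT : ∀ i ∈ (Finset.range (r - 1)).map succEmb, i < r := by
        intro i hi
        obtain ⟨j, hj, rfl⟩ := Finset.mem_map.mp hi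
        exact hS j hj
      simpa using card_le_algDeg hT (hshift ▸ one_ne_zero)
    · simpa using card_le_algDeg (fun i hi => (Nat.lt_succ_self i).trans (hS i hi)) h
  · refine (two_pow_div_three_le_card_ne_zero
      (fun n => natAnf B (Finset.equivBitIndices n)) r fun n h1 h2 => ?_).trans
      (card_natAnf_ne_zero_le_sparsity B)
    rw [equivBitIndices_two_mul]
    refine natAnf_map_succ hB (fun i hi => ?_) (Finset.nonempty_iff_ne_empty.mpr fun h => ?_)
    · apply lt_of_mem_equivBitIndices h2
      rw [equivBitIndices_two_mul]
      exact Finset.mem_map_of_mem succEmb hi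
    · have : n = 0 := by
        rw [← Finset.equivBitIndices.symm_apply_apply n, h]
        rfl
      omega
end

section
/- A binary sequence S = (s_n)_{n=1}^∞ over 𝔽₂ satisfies S(S,N) = ⌊N/2⌋ for all N ≥ 1 if and only if s_{2n} = 1 - s_n for all n = 1, 2, …. -/
open scoped BigOperators

/-- The sequence `(s_n)` passes the `S`-dimensional `N`-lattice test if the vectors
`(s_n - s_1, s_{n+1} - s_2, …, s_{n+S-1} - s_S)`, `n = 2, 3, …, N - S + 1`,
span `𝔽₂^S`. -/
def passesLatticeTest (s : ℕ → ZMod 2) (N S : ℕ) : Prop :=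
  Submodule.span (ZMod 2)
      {v : Fin S → ZMod 2 |
        ∃ n : ℕ, 2 ≤ n ∧ n ≤ N - S + 1 ∧
          v = fun i : Fin S => s (n + (i : ℕ)) - s (1 + (i : ℕ))} = ⊤

/-- The `N`th lattice level: the greatest positive `S` such that the sequence passes the
`S`-dimensional `N`-lattice test (and `0` if there is no such `S`). -/
noncomputable def latticeLevel (s : ℕ → ZMod 2) (N : ℕ) : ℕ :=
  sSup {S : ℕ | 0 < S ∧ passesLatticeTest s N S}

/-- The `N`th linear complexity: the smallest `L` such that
`s_{n+L} = c_{L-1} s_{n+L-1} + … + c_0 s_n` for `n = 1, …, N - L` and some fixed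
`c_0, …, c_{L-1} ∈ 𝔽₂`.  (The conventions `L = 0` for the zero segment and `L = N` for
`s_1 = … = s_{N-1} = 0`, `s_N = 1` are automatic: for `L = 0` the condition reads
`s_n = 0` for `1 ≤ n ≤ N`, and for `L = N` it is vacuous.) -/
noncomputable def linComplexity (s : ℕ → ZMod 2) (N : ℕ) : ℕ :=
  sInf {L : ℕ | ∃ c : Fin L → ZMod 2,
    ∀ n : ℕ, 1 ≤ n → n + L ≤ N → s (n + L) = ∑ i : Fin L, c i * s (n + (i : ℕ))}

/-- The Hankel matrix `(t_{1+i+j})` of size `S` has trivial kernel. -/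
def HankelNondegenerate (t : ℕ → ZMod 2) (S : ℕ) : Prop :=
  ∀ c : Fin S → ZMod 2,
    (∀ n, 1 ≤ n → n ≤ S → ∑ i : Fin S, c i * t (n + (i : ℕ)) = 0) → c = 0

lemma ZMod.two_powerSeries_eq_zero : (2 : PowerSeries (ZMod 2)) = 0 := by
  rw [← map_ofNat (PowerSeries.C (R := ZMod 2)) 2, show (OfNat.ofNat 2 : ZMod 2) = 0 from rfl,
    map_zero]

lemma PowerSeries.coeff_two_mul_sq (G : PowerSeries (ZMod 2)) (n : ℕ) :
    coeff (2 * n) (G ^ 2) = coeff n G := by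
  have hmem : (n, n) ∈ Finset.HasAntidiagonal.antidiagonal (2 * n) := by
    rw [Finset.HasAntidiagonal.mem_antidiagonal]
    ring
  rw [sq, coeff_mul, ← Finset.sum_erase_add _ _ hmem]
  rw [Finset.sum_involution (fun p _ => p.swap)]
  · generalize coeff n G = a
    revert a
    decide
  · intro p _
    simp only [Prod.fst_swap, Prod.snd_swap]
    rw [mul_comm]
    exact CharTwo.add_self_eq_zero _
  · rintro ⟨a, b⟩ hp _ h
    simp at hp h
    omega
  · rintro ⟨a, b⟩ hp
    simp at hp ⊢
    omega
  · intro p _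
    exact Prod.swap_swap p

lemma PowerSeries.derivative_eq_zero_iff_coeff_odd (F : PowerSeries (ZMod 2)) :
    derivative (ZMod 2) F = 0 ↔ ∀ n, coeff (2 * n + 1) F = 0 := by
  constructor
  · intro h n
    have := congrArg (coeff (2 * n)) h
    rw [coeff_derivative] at this
    have h2 : (2 : ZMod 2) = 0 := rfl
    simpa [h2] using this
  · intro h
    ext k
    rw [coeff_derivative]
    rcases Nat.even_or_odd' k with ⟨m, rfl | rfl⟩
    · simp [h]
    · have h2 : ((2 * m + 1 : ℕ) : ZMod 2) + 1 = 0 := by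
        have : (2 : ZMod 2) = 0 := rfl
        push_cast
        rw [this]
        simp only [zero_mul, zero_add]
        rfl
      rw [h2]
      simp

lemma PowerSeries.coeff_odd_sq_mul (Q F : PowerSeries (ZMod 2))
    (hF : ∀ n, coeff (2 * n + 1) F = 0) (n : ℕ) : coeff (2 * n + 1) (Q ^ 2 * F) = 0 := by
  revert n
  rw [← derivative_eq_zero_iff_coeff_odd] at hF ⊢
  rw [Derivation.leibniz, hF, sq, Derivation.leibniz]
  simp only [smul_eq_mul]
  linear_combination F * Q * derivative (ZMod 2) Q * ZMod.two_powerSeries_eq_zero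

open Polynomial in
/-- A consequence of the anisotropy of `p² + pq + q²` over `𝔽₂`, applied to leading coefficients. -/
lemma eq_zero_of_coeff_odd_eq_zero (P Q : (ZMod 2)[X]) (S : ℕ)
    (hP : P.natDegree < S) (hQ : Q.natDegree < S)
    (h : ∀ n, 2 * n + 1 < 2 * S →
      ((1 + X) * (Q * P) + X * P ^ 2 + X * Q ^ 2).coeff (2 * n + 1) = 0) :
    Q = 0 := by
  set D := max P.natDegree Q.natDegree with hD
  have hPD : P.natDegree ≤ D := le_max_left _ _
  have hQD : Q.natDegree ≤ D := le_max_right _ _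
  have hDS : D < S := max_lt hP hQ
  have h0 := h D (by omega)
  have e : (1 + X) * (Q * P) + X * P ^ 2 + X * Q ^ 2
      = Q * P + X * (Q * P) + X * (P * P) + X * (Q * Q) := by ring
  have hlt : (Q * P).coeff (2 * D + 1) = 0 := by
    apply coeff_eq_zero_of_natDegree_lt
    have := natDegree_mul_le (p := Q) (q := P)
    omega
  rw [e] at h0
  simp only [coeff_add, coeff_X_mul] at h0
  rw [hlt, two_mul, coeff_mul_add_eq_of_natDegree_le hQD hPD,
    coeff_mul_add_eq_of_natDegree_le hPD hPD, coeff_mul_add_eq_of_natDegree_le hQD hQD] at h0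
  have key : ∀ p q : ZMod 2, 0 + q * p + p * p + q * q = 0 → p = 0 ∧ q = 0 := by decide
  obtain ⟨hp, hq⟩ := key _ _ h0
  rcases max_choice P.natDegree Q.natDegree with hm | hm
  · rw [← hD] at hm
    rw [hm] at hp
    have hP0 : P = 0 := leadingCoeff_eq_zero.mp hp
    have hD0 : D = 0 := by rw [hm, hP0, natDegree_zero]
    have : Q.natDegree = D := by omega
    rw [← this] at hq
    exact leadingCoeff_eq_zero.mp hq
  · rw [← hD] at hm
    rw [hm] at hq
    exact leadingCoeff_eq_zero.mp hq

open Polynomial in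
lemma hankelNondegenerate_of_recurrence (t : ℕ → ZMod 2) (h0 : t 0 = 0) (h1 : t 1 = 1)
    (ht : ∀ n, 1 ≤ n → t (2 * n + 1) = t (2 * n) + t n) (S : ℕ) :
    HankelNondegenerate t S := by
  intro c hc
  set G : PowerSeries (ZMod 2) := PowerSeries.mk t with hG
  set Q : (ZMod 2)[X] := ∑ i : Fin S, C (c i) * X ^ (S - 1 - (i : ℕ)) with hQ
  rcases Nat.eq_zero_or_pos S with rfl | hS
  · exact Subsingleton.elim _ _
  have hQdeg : Q.natDegree < S := by
    have : Q.natDegree ≤ S - 1 := by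
      apply natDegree_sum_le_of_forall_le
      intro i _
      exact (natDegree_C_mul_X_pow_le _ _).trans (by omega)
    omega
  have hQc : ∀ i : Fin S, Q.coeff (S - 1 - (i : ℕ)) = c i := by
    intro i
    rw [hQ, finsetSum_coeff, Finset.sum_eq_single i]
    · simp
    · intro j _ hj
      rw [coeff_C_mul_X_pow, if_neg]
      have := i.2
      have := j.2
      intro h
      apply hj
      ext
      omega
    · simp
  have hmid : ∀ k, S ≤ k → k < 2 * S →
      PowerSeries.coeff k ((Q : PowerSeries (ZMod 2)) * G) = 0 := by
    intro k hk hk'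
    have hn := hc (k - (S - 1)) (by omega) (by omega)
    have eQ : (Q : PowerSeries (ZMod 2))
        = ∑ i : Fin S, PowerSeries.C (c i) * PowerSeries.X ^ (S - 1 - (i : ℕ)) := by
      rw [hQ, ← Polynomial.coeToPowerSeries.ringHom_apply, map_sum]
      simp
    rw [eQ, Finset.sum_mul, map_sum, ← hn]
    apply Finset.sum_congr rfl
    intro i _
    rw [mul_assoc, PowerSeries.coeff_C_mul, PowerSeries.coeff_X_pow_mul', if_pos (by omega), hG,
      PowerSeries.coeff_mk]
    have := i.2
    congr 2
    omega
  set P : (ZMod 2)[X] := PowerSeries.trunc S ((Q : PowerSeries (ZMod 2)) * G) with hP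
  have hPdeg : P.natDegree < S := by
    obtain ⟨m, rfl⟩ := Nat.exists_eq_succ_of_ne_zero hS.ne'
    exact PowerSeries.natDegree_trunc_lt _ _
  obtain ⟨R, hR⟩ : (PowerSeries.X : PowerSeries (ZMod 2)) ^ (2 * S) ∣
      (Q : PowerSeries (ZMod 2)) * G - P := by
    rw [PowerSeries.X_pow_dvd_iff]
    intro m hm
    rw [map_sub, Polynomial.coeff_coe, hP, PowerSeries.coeff_trunc]
    split_ifs with hmS
    · simp
    · rw [hmid m (by omega) hm, sub_zero]
  have hF : ∀ n, PowerSeries.coeff (2 * n + 1)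
      ((1 + PowerSeries.X) * G + PowerSeries.X * G ^ 2 + PowerSeries.X) = 0 := by
    intro n
    rw [add_mul, one_mul, map_add, map_add, map_add, PowerSeries.coeff_succ_X_mul,
      PowerSeries.coeff_succ_X_mul, PowerSeries.coeff_two_mul_sq, PowerSeries.coeff_X, hG]
    simp only [PowerSeries.coeff_mk]
    rcases Nat.eq_zero_or_pos n with rfl | hn
    · simp [h0, h1]
      rfl
    · rw [ht n hn, if_neg (by omega)]
      generalize t (2 * n) = a
      generalize t n = b
      revert a b
      decide
  have hQ0 : Q = 0 := by
    refine eq_zero_of_coeff_odd_eq_zero P Q S hPdeg hQdeg fun n hn => ?_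
    have h2 := PowerSeries.coeff_odd_sq_mul (Q : PowerSeries (ZMod 2)) _ hF n
    have e : (Q : PowerSeries (ZMod 2)) ^ 2 *
          ((1 + PowerSeries.X) * G + PowerSeries.X * G ^ 2 + PowerSeries.X)
        = (((1 + X) * (Q * P) + X * P ^ 2 + X * Q ^ 2 : (ZMod 2)[X]) : PowerSeries (ZMod 2))
          + PowerSeries.X ^ (2 * S) * (R * ((1 + PowerSeries.X) * (Q : PowerSeries (ZMod 2))
            + PowerSeries.X * (2 * (P : PowerSeries (ZMod 2)) + PowerSeries.X ^ (2 * S) * R))) := by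
      have hR' := sub_eq_iff_eq_add.mp hR
      push_cast
      linear_combination ((1 + PowerSeries.X) * (Q : PowerSeries (ZMod 2))
        + PowerSeries.X * (Q * G + PowerSeries.X ^ (2 * S) * R + P)) * hR'
    rw [e, map_add, Polynomial.coeff_coe, PowerSeries.coeff_X_pow_mul', if_neg (by omega),
      add_zero] at h2
    exact h2
  ext i
  rw [← hQc i, hQ0]
  simp

/-- Nondegeneracy of two consecutive Hankel matrices determines the corner entry. -/
lemma HankelNondegenerate.corner_unique {t t' : ℕ → ZMod 2} {m : ℕ}
    (h : HankelNondegenerate t m) (h1 : HankelNondegenerate t (m + 1))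
    (h1' : HankelNondegenerate t' (m + 1)) (heq : ∀ k, 1 ≤ k → k < 2 * m + 1 → t k = t' k) :
    t (2 * m + 1) = t' (2 * m + 1) := by
  by_contra hne
  let A : Matrix (Fin (m + 1)) (Fin (m + 1)) (ZMod 2) :=
    Matrix.of fun i j => t (1 + (i : ℕ) + (j : ℕ))
  have hA : ∀ c i, A.mulVecLin c i = ∑ j, c j * t (1 + (i : ℕ) + (j : ℕ)) := by
    intro c i
    simp [A, Matrix.mulVec, dotProduct, mul_comm]
  have hinj : Function.Injective A.mulVecLin := by
    rw [← LinearMap.ker_eq_bot, LinearMap.ker_eq_bot']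
    intro c hc
    apply h1 c
    intro n hn hn'
    have := congrFun hc ⟨n - 1, by omega⟩
    rw [hA] at this
    simpa [Nat.add_sub_cancel' hn] using this
  obtain ⟨c, hc⟩ := LinearMap.injective_iff_surjective.mp hinj (Pi.single (Fin.last m) 1)
  have hrow : ∀ i : Fin (m + 1),
      ∑ j : Fin m, c j.castSucc * t (1 + (i : ℕ) + (j : ℕ)) + c (Fin.last m) * t (1 + (i : ℕ) + m)
        = (Pi.single (Fin.last m) 1 : Fin (m + 1) → ZMod 2) i := by
    intro i
    rw [← hc, hA, Fin.sum_univ_castSucc]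
    simp
  have hlast : c (Fin.last m) ≠ 0 := by
    intro h0
    have hz := h (fun j => c j.castSucc) (by
      intro n hn hn'
      have := hrow ⟨n - 1, by omega⟩
      rw [h0, Pi.single_eq_of_ne (by intro e; have := congrArg Fin.val e; simp at this; omega)]
        at this
      simpa [Nat.add_sub_cancel' hn] using this)
    have := hrow (Fin.last m)
    rw [h0, Finset.sum_eq_zero (fun j _ => by rw [congrFun hz j]; simp)] at this
    simp at this
  have hc1 : c (Fin.last m) = 1 := by
    generalize c (Fin.last m) = a at hlast
    revert a
    decide
  refine hlast (congrFun (h1' c ?_) (Fin.last m))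
  intro n hn hn'
  rw [Fin.sum_univ_castSucc]
  simp only [Fin.val_castSucc, Fin.val_last]
  have hr := hrow ⟨n - 1, by omega⟩
  simp only [Nat.add_sub_cancel' hn] at hr
  have hs : ∑ j : Fin m, c j.castSucc * t' (n + (j : ℕ))
      = ∑ j : Fin m, c j.castSucc * t (n + (j : ℕ)) :=
    Finset.sum_congr rfl fun j _ => by rw [heq _ (by omega) (by have := j.2; omega)]
  rw [hs]
  rcases Nat.lt_or_ge n (m + 1) with hlt | hge
  · rw [Pi.single_eq_of_ne (by intro e; have := congrArg Fin.val e; simp at this; omega)] at hr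
    rw [← heq (n + m) (by omega) (by omega)]
    exact hr
  · obtain rfl : n = m + 1 := by omega
    have e : (⟨m + 1 - 1, by omega⟩ : Fin (m + 1)) = Fin.last m := rfl
    rw [e, Pi.single_eq_same, hc1] at hr
    rw [hc1]
    have e2 : m + 1 + m = 2 * m + 1 := by ring
    rw [e2] at hr ⊢
    revert hr hne
    generalize (∑ j : Fin m, c j.castSucc * t (m + 1 + (j : ℕ))) = x
    generalize t (2 * m + 1) = y
    generalize t' (2 * m + 1) = z
    revert x y z
    decide

lemma passesLatticeTest.two_mul_le {s : ℕ → ZMod 2} {N S : ℕ} (hS : 0 < S)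
    (h : passesLatticeTest s N S) : 2 * S ≤ N := by
  classical
  have hset : {v : Fin S → ZMod 2 | ∃ n : ℕ, 2 ≤ n ∧ n ≤ N - S + 1 ∧
      v = fun i : Fin S => s (n + (i : ℕ)) - s (1 + (i : ℕ))}
      = ((Finset.Icc 2 (N - S + 1)).image fun n => fun i : Fin S =>
          s (n + (i : ℕ)) - s (1 + (i : ℕ)) : Finset (Fin S → ZMod 2)) := by
    ext v
    simp only [Set.mem_ofPred_eq, Finset.coe_image, Set.mem_image, Finset.coe_Icc, Set.mem_Icc]
    constructor
    · rintro ⟨n, h1, h2, rfl⟩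
      exact ⟨n, ⟨h1, h2⟩, rfl⟩
    · rintro ⟨n, ⟨h1, h2⟩, rfl⟩
      exact ⟨n, h1, h2, rfl⟩
  rw [passesLatticeTest, hset] at h
  have h1 := finrank_span_finset_le_card (R := ZMod 2)
    ((Finset.Icc 2 (N - S + 1)).image fun n => fun i : Fin S =>
          s (n + (i : ℕ)) - s (1 + (i : ℕ)))
  rw [Set.finrank, h, finrank_top, Module.finrank_fin_fun] at h1
  have h2 := h1.trans Finset.card_image_le
  rw [Nat.card_Icc] at h2
  omega

lemma passesLatticeTest.mono {s : ℕ → ZMod 2} {N N' S : ℕ} (hN : N ≤ N')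
    (h : passesLatticeTest s N S) : passesLatticeTest s N' S := by
  rw [passesLatticeTest, eq_top_iff] at h ⊢
  refine h.trans (Submodule.span_mono ?_)
  rintro v ⟨n, h1, h2, hv⟩
  exact ⟨n, h1, by omega, hv⟩

lemma latticeLevel_eq_half_iff (s : ℕ → ZMod 2) :
    (∀ N : ℕ, 1 ≤ N → latticeLevel s N = N / 2) ↔
      ∀ S, 1 ≤ S → passesLatticeTest s (2 * S) S := by
  have hub : ∀ N S, S ∈ {S : ℕ | 0 < S ∧ passesLatticeTest s N S} → S ≤ N / 2 := by
    rintro N S ⟨h1, h2⟩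
    have := h2.two_mul_le h1
    omega
  constructor
  · intro h S hS
    have h1 := h (2 * S) (by omega)
    rw [Nat.mul_div_cancel_left S two_pos] at h1
    rcases Set.eq_empty_or_nonempty {S' : ℕ | 0 < S' ∧ passesLatticeTest s (2 * S) S'} with he | he
    · rw [latticeLevel, he, csSup_empty] at h1
      simp at h1
      omega
    · have := Nat.sSup_mem he ⟨_, hub (2 * S)⟩
      rw [latticeLevel] at h1
      rw [h1] at this
      exact this.2
  · intro h N _
    rcases Nat.eq_zero_or_pos (N / 2) with h0 | hpos
    · have he : {S : ℕ | 0 < S ∧ passesLatticeTest s N S} = ∅ := by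
        rw [Set.eq_empty_iff_forall_notMem]
        intro S hS
        have := hub N S hS
        have := hS.1
        omega
      rw [latticeLevel, he, csSup_empty, h0]
      rfl
    · have : IsGreatest {S : ℕ | 0 < S ∧ passesLatticeTest s N S} (N / 2) :=
        ⟨⟨hpos, (h (N / 2) hpos).mono (by omega)⟩, hub N⟩
      exact this.csSup_eq

lemma passesLatticeTest_two_mul_iff (s : ℕ → ZMod 2) (S : ℕ) :
    passesLatticeTest s (2 * S) S ↔ HankelNondegenerate (fun n => s (n + 1) - s n) S := by
  have hN : 2 * S - S + 1 = S + 1 := by omega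
  rw [passesLatticeTest, hN]
  constructor
  · intro h c hc
    have hconst : ∀ n, 1 ≤ n → n ≤ S + 1 →
        ∑ i : Fin S, c i * (s (n + (i : ℕ)) - s (1 + (i : ℕ))) = 0 := by
      intro n hn
      induction n, hn using Nat.le_induction with
      | base => simp
      | succ n hn ih =>
        intro hle
        rw [← add_zero (0 : ZMod 2)]
        nth_rw 1 [← ih (by omega)]
        rw [← hc n hn (by omega), ← Finset.sum_add_distrib]
        refine Finset.sum_congr rfl fun i _ => ?_
        rw [show n + 1 + (i : ℕ) = n + i + 1 by ring]
        ring
    let f : (Fin S → ZMod 2) →ₗ[ZMod 2] ZMod 2 := ∑ i, c i • LinearMap.proj i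
    have hf : ∀ v, f v = ∑ i, c i * v i := by intro v; simp [f]
    have hker : (⊤ : Submodule (ZMod 2) (Fin S → ZMod 2)) ≤ LinearMap.ker f := by
      rw [← h, Submodule.span_le]
      rintro v ⟨n, h1, h2, rfl⟩
      simp only [SetLike.mem_coe, LinearMap.mem_ker]
      rw [hf]
      exact hconst n (by omega) h2
    ext i
    have : f (Pi.single i 1) = 0 := hker (x := Pi.single i 1) trivial
    rw [hf] at this
    simpa [Pi.single_apply] using this
  · intro h
    by_contra hne
    obtain ⟨f, hf0, hf⟩ := Submodule.exists_le_ker_of_lt_top _ (lt_top_iff_ne_top.mpr hne)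
    have hfs : ∀ v, f v = ∑ i, f (Pi.single i 1) * v i := by
      intro v
      conv_lhs => rw [pi_eq_sum_univ' v]
      simp only [map_sum, map_smul, smul_eq_mul]
      refine Finset.sum_congr rfl fun i _ => ?_
      rw [mul_comm]
    have hz : ∀ n, 1 ≤ n → n ≤ S + 1 →
        f (fun i : Fin S => s (n + (i : ℕ)) - s (1 + (i : ℕ))) = 0 := by
      intro n hn hn'
      rcases Nat.eq_or_lt_of_le hn with rfl | hlt
      · rw [hfs]
        simp
      · exact hf (Submodule.subset_span ⟨n, hlt, hn', rfl⟩)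
    have hc := h (fun i => f (Pi.single i 1)) (by
      intro n hn hn'
      have e := congrArg₂ (· - ·) (hz (n + 1) (by omega) (by omega)) (hz n hn (by omega))
      simp only [sub_zero] at e
      rw [← e, hfs, hfs, ← Finset.sum_sub_distrib]
      refine Finset.sum_congr rfl fun i _ => ?_
      rw [show n + 1 + (i : ℕ) = n + i + 1 by ring]
      ring)
    apply hf0
    ext i
    simpa using congrFun hc i

lemma hankelNondegenerate_of_two_mul (s : ℕ → ZMod 2)
    (h : ∀ n : ℕ, 1 ≤ n → s (2 * n) = 1 - s n) (S : ℕ) :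
    HankelNondegenerate (fun n => s (n + 1) - s n) S := by
  have key := hankelNondegenerate_of_recurrence
    (fun n => if n = 0 then 0 else s (n + 1) - s n) (by simp)
    (by simp [show s 2 = 1 - s 1 from h 1 le_rfl]; generalize s 1 = a; revert a; decide)
    (by
      intro n hn
      have h1 := h n hn
      have h2 : s (2 * n + 1 + 1) = 1 - s (n + 1) := h (n + 1) (by omega)
      simp only [if_neg (show 2 * n + 1 ≠ 0 by omega), if_neg (show 2 * n ≠ 0 by omega),
        if_neg (show n ≠ 0 by omega), h1, h2]
      generalize s (n + 1) = a
      generalize s n = b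
      generalize s (2 * n + 1) = c
      revert a b c
      decide) S
  intro c hc
  apply key c
  intro n hn hn'
  refine (Finset.sum_congr rfl fun i _ => ?_).trans (hc n hn hn')
  simp only [if_neg (show n + (i : ℕ) ≠ 0 by omega)]

lemma exists_two_mul_extension (s : ℕ → ZMod 2) :
    ∃ s' : ℕ → ZMod 2, (∀ n, 1 ≤ n → s' (2 * n) = 1 - s' n) ∧
      ∀ n, s' (2 * n + 1) = s (2 * n + 1) := by
  refine ⟨fun n => s (ordCompl[2] n) + n.factorization 2, fun n hn => ?_, fun n => ?_⟩
  · have hf : (2 * n).factorization 2 = n.factorization 2 + 1 := by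
      rw [Nat.factorization_mul (by norm_num) (by omega)]
      simp [Nat.Prime.factorization Nat.prime_two, add_comm]
    have ho : 2 * n / 2 ^ (2 * n).factorization 2 = n / 2 ^ n.factorization 2 := by
      rw [hf, pow_succ', Nat.mul_div_mul_left _ _ two_pos]
    simp only [ho]
    rw [hf]
    push_cast
    generalize s _ = a
    generalize (n.factorization 2 : ZMod 2) = b
    revert a b
    decide
  · have hf : (2 * n + 1).factorization 2 = 0 :=
      Nat.factorization_eq_zero_of_not_dvd (by omega)
    simp [hf]

theorem stmt10 (s : ℕ → ZMod 2) :
    (∀ N : ℕ, 1 ≤ N → latticeLevel s N = N / 2) ↔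
      (∀ n : ℕ, 1 ≤ n → s (2 * n) = 1 - s n) := by
  rw [latticeLevel_eq_half_iff]
  simp only [passesLatticeTest_two_mul_iff]
  refine ⟨fun h => ?_, fun h S _ => hankelNondegenerate_of_two_mul s h S⟩
  obtain ⟨s', hs', hodd⟩ := exists_two_mul_extension s
  have hall : ∀ k, 1 ≤ k → s k = s' k := by
    intro k
    induction k using Nat.strong_induction_on with
    | _ k ih =>
      intro hk
      rcases Nat.even_or_odd' k with ⟨m, rfl | rfl⟩
      · obtain ⟨m, rfl⟩ := Nat.exists_eq_succ_of_ne_zero (show m ≠ 0 by omega)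
        have hm : HankelNondegenerate (fun n => s (n + 1) - s n) m := by
          rcases Nat.eq_zero_or_pos m with rfl | hm
          · exact fun c _ => Subsingleton.elim _ _
          · exact h m hm
        have hc := hm.corner_unique (h (m + 1) (by omega))
          (hankelNondegenerate_of_two_mul s' hs' (m + 1)) (by
            intro k hk hk'
            rw [ih k (by omega) hk, ih (k + 1) (by omega) (by omega)])
        rw [ih (2 * m + 1) (by omega) (by omega)] at hc
        exact sub_left_injective hc
      · exact (hodd m).symm
  intro n hn
  rw [hall _ (by omega), hall n hn, hs' n hn]
end

section
/- For every binary sequence S = (s_n)_{n=1}^∞ over 𝔽₂ and every N ≥ 1, either S(S,N) = min{L(S,N), N + 1 - L(S,N)} or S(S,N) = min{L(S,N), N + 1 - L(S,N)} - 1. -/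
open scoped BigOperators

open Polynomial

/-- The left shift on sequences, as a linear endomorphism. -/
def shiftEnd (F : Type*) [Field F] : Module.End F (ℕ → F) :=
  LinearMap.funLeft F F Nat.succ

section Shift

variable {F : Type*} [Field F]

lemma shiftEnd_pow_apply (s : ℕ → F) (i n : ℕ) : (shiftEnd F ^ i) s n = s (n + i) := by
  induction i generalizing n with
  | zero => simp
  | succ i ih =>
    rw [pow_succ', Module.End.mul_apply, shiftEnd, LinearMap.funLeft_apply, ← shiftEnd, ih]
    congr 1
    omega

lemma aeval_shiftEnd_apply (s : ℕ → F) {P : F[X]} {d : ℕ} (h : P.natDegree < d) (n : ℕ) :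
    aeval (shiftEnd F) P s n = ∑ i : Fin d, P.coeff i * s (n + i) := by
  rw [aeval_eq_sum_range' h, Finset.sum_range]
  simp [LinearMap.sum_apply, shiftEnd_pow_apply]

lemma aeval_shiftEnd_ofFn_apply [DecidableEq F] (s : ℕ → F) {d : ℕ} (b : Fin d → F) (n : ℕ) :
    aeval (shiftEnd F) (ofFn d b) s n = ∑ i : Fin d, b i * s (n + i) := by
  rcases Nat.eq_zero_or_pos d with rfl | hd
  · simp [Subsingleton.elim b 0]
  · rw [aeval_shiftEnd_apply s (ofFn_natDegree_lt hd b)]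
    refine Finset.sum_congr rfl fun i _ => ?_
    rw [ofFn_coeff_eq_val_of_lt b i.2]

lemma LinearMap.apply_eq_sum_single_mul {ι : Type*} [Fintype ι] [DecidableEq ι]
    (f : Module.Dual F (ι → F)) (v : ι → F) : f v = ∑ i, f (Pi.single i 1) * v i := by
  rw [LinearMap.pi_apply_eq_sum_univ f v]
  refine Finset.sum_congr rfl fun i _ => ?_
  rw [smul_eq_mul, mul_comm]
  congr 2
  ext j
  simp [Pi.single_apply, eq_comm]

/-- A sequence whose first `P.natDegree` terms vanish and which is annihilated by the monic
polynomial `P` along an initial segment vanishes on that segment. -/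
lemma eq_zero_of_aeval_shiftEnd_eq_zero {t : ℕ → F} {P : F[X]} (hP : P.Monic) {M : ℕ}
    (hrec : ∀ n, 1 ≤ n → n + P.natDegree ≤ M → aeval (shiftEnd F) P t n = 0)
    (hinit : ∀ n, 1 ≤ n → n ≤ P.natDegree → t n = 0) :
    ∀ n, 1 ≤ n → n ≤ M → t n = 0 := by
  intro n
  induction n using Nat.strong_induction_on with
  | _ n ih =>
    intro h1 hM
    by_cases hn : n ≤ P.natDegree
    · exact hinit n h1 hn
    · obtain ⟨m, rfl⟩ := Nat.exists_eq_add_of_lt (not_le.1 hn)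
      have h := hrec (m + 1) (by omega) (by omega)
      rw [aeval_shiftEnd_apply t (Nat.lt_succ_self _), Fin.sum_univ_castSucc,
        Finset.sum_eq_zero, zero_add] at h
      · simp only [Fin.val_last, hP.coeff_natDegree, one_mul] at h
        rw [← h]
        congr 1
        omega
      · intro i _
        have := i.2
        rw [ih (m + 1 + (i.castSucc : Fin _)) (by simp; omega) (by omega) (by simp; omega),
          mul_zero]

/-- If the recurrence with characteristic polynomial `P` generates the first `N` terms of `s` and
`Q` annihilates `s` at the first `P.natDegree` positions, then `Q` annihilates `s` at every
position inside the first `N` terms. -/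
lemma aeval_shiftEnd_eq_zero_of_initial {s : ℕ → F} {N : ℕ} {P Q : F[X]} (hP : P.Monic)
    (hrec : ∀ n, 1 ≤ n → n + P.natDegree ≤ N → aeval (shiftEnd F) P s n = 0)
    (hinit : ∀ n, 1 ≤ n → n ≤ P.natDegree → aeval (shiftEnd F) Q s n = 0) :
    ∀ n, 1 ≤ n → n + Q.natDegree ≤ N → aeval (shiftEnd F) Q s n = 0 := by
  have key := eq_zero_of_aeval_shiftEnd_eq_zero (t := aeval (shiftEnd F) Q s)
    (M := N - Q.natDegree) hP ?_ hinit
  · exact fun n h1 h2 => key n h1 (by omega)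
  · intro n h1 h2
    by_cases hn : n + P.natDegree + Q.natDegree ≤ N
    · rw [← Module.End.mul_apply, ← map_mul, mul_comm, map_mul, Module.End.mul_apply,
        aeval_shiftEnd_apply _ (Nat.lt_succ_self _)]
      refine Finset.sum_eq_zero fun i _ => ?_
      have := i.2
      rw [hrec _ (by omega) (by omega), mul_zero]
    · omega

/-- If no recurrence of length `d` generates the first `M + d` terms of `s`, then some nonzero
polynomial of degree less than `M` annihilates `s` at the first `d` positions. -/
lemma exists_annihilator_of_not_recurrence {s : ℕ → F} {d M : ℕ}
    (h : ¬ ∃ c : Fin d → F, ∀ n, 1 ≤ n → n ≤ M → s (n + d) = ∑ i, c i * s (n + (i : ℕ))) :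
    ∃ Q : F[X], Q ≠ 0 ∧ Q.natDegree < M ∧
      ∀ n, 1 ≤ n → n ≤ d → aeval (shiftEnd F) Q s n = 0 := by
  classical
  let col : ℕ → Fin M → F := fun i n => s (i + 1 + n)
  have hcol : col d ∉ Submodule.span F (Set.range fun i : Fin d => col i) := by
    intro hmem
    obtain ⟨c, hc⟩ := (Submodule.mem_span_range_iff_exists_fun F).1 hmem
    refine h ⟨c, fun n h1 h2 => ?_⟩
    have := congrFun hc ⟨n - 1, by omega⟩
    simp only [Finset.sum_apply, Pi.smul_apply, smul_eq_mul, col] at this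
    rw [show n + d = d + 1 + (n - 1) by omega, ← this]
    refine Finset.sum_congr rfl fun i _ => ?_
    congr 2
    omega
  obtain ⟨f, hf, hker⟩ := Submodule.exists_le_ker_of_notMem hcol
  have hQ (i : ℕ) : aeval (shiftEnd F) (ofFn M fun j => f (Pi.single j 1)) s (i + 1) =
      f (col i) := by
    rw [aeval_shiftEnd_ofFn_apply, LinearMap.apply_eq_sum_single_mul f]
  have hQ0 : ofFn M (fun j => f (Pi.single j 1)) ≠ 0 := by
    intro h0
    exact hf (by rw [← hQ, h0]; simp)
  have hM : 1 ≤ M := by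
    by_contra hM
    obtain rfl : M = 0 := by omega
    exact hf (by rw [Subsingleton.elim (col d) 0, map_zero])
  refine ⟨_, hQ0, ofFn_natDegree_lt hM _, fun n h1 h2 => ?_⟩
  obtain ⟨i, rfl⟩ := Nat.exists_eq_add_of_le' h1
  rw [hQ]
  exact hker (Submodule.subset_span ⟨⟨i, by omega⟩, rfl⟩)

/-- A linear recurrence of length `L` is the same as annihilation by a monic polynomial of
degree `L`. -/
lemma exists_recurrence_iff_exists_monic (s : ℕ → F) (N L : ℕ) :
    (∃ c : Fin L → F, ∀ n : ℕ, 1 ≤ n → n + L ≤ N →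
        s (n + L) = ∑ i : Fin L, c i * s (n + (i : ℕ))) ↔
      ∃ P : F[X], P.Monic ∧ P.natDegree = L ∧
        ∀ n, 1 ≤ n → n + L ≤ N → aeval (shiftEnd F) P s n = 0 := by
  classical
  constructor
  · rintro ⟨c, hc⟩
    have hdeg := ofFn_degree_lt c
    refine ⟨X ^ L - ofFn L c, monic_X_pow_sub hdeg, ?_, fun n h1 h2 => ?_⟩
    · rw [natDegree_eq_of_degree_eq (degree_sub_eq_left_of_degree_lt (by simpa using hdeg))]
      simp
    · rw [map_sub, LinearMap.sub_apply, Pi.sub_apply, aeval_shiftEnd_ofFn_apply, map_pow, aeval_X,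
        shiftEnd_pow_apply, hc n h1 h2, sub_self]
  · rintro ⟨P, hP, rfl, hrec⟩
    refine ⟨fun i => -P.coeff i, fun n h1 h2 => ?_⟩
    have h := hrec n h1 h2
    rw [aeval_shiftEnd_apply s (Nat.lt_succ_self _), Fin.sum_univ_castSucc] at h
    simp only [Fin.val_last, hP.coeff_natDegree, one_mul, Fin.val_castSucc] at h
    simp only [neg_mul, Finset.sum_neg_distrib]
    exact eq_neg_of_add_eq_zero_right h

end Shift

lemma not_passesLatticeTest_iff (s : ℕ → ZMod 2) (N S : ℕ) :
    ¬ passesLatticeTest s N S ↔ ∃ P : (ZMod 2)[X], P ≠ 0 ∧ P.natDegree < S ∧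
      ∃ e, ∀ n, 1 ≤ n → n + S ≤ N + 1 → aeval (shiftEnd (ZMod 2)) P s n = e := by
  constructor
  · intro h
    obtain ⟨f, hf, hker⟩ := Submodule.exists_le_ker_of_lt_top _ (lt_top_iff_ne_top.2 h)
    have hQ (n : ℕ) : aeval (shiftEnd (ZMod 2)) (ofFn S fun j => f (Pi.single j 1)) s n =
        f fun i => s (n + i) := by
      rw [aeval_shiftEnd_ofFn_apply, LinearMap.apply_eq_sum_single_mul f]
    have hS : 1 ≤ S := by
      by_contra hS
      obtain rfl : S = 0 := by omega
      exact hf (LinearMap.ext fun v => by rw [Subsingleton.elim v 0, map_zero, map_zero])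
    refine ⟨ofFn S fun j => f (Pi.single j 1), fun h0 => hf ?_, ofFn_natDegree_lt hS _,
      f fun i => s (1 + i), fun n h1 h2 => ?_⟩
    · ext i
      have := ofFn_coeff_eq_val_of_lt (fun j => f (Pi.single j 1)) i.2
      rw [h0] at this
      simpa using this.symm
    · rw [hQ]
      rcases h1.eq_or_lt with rfl | h1
      · rfl
      · exact sub_eq_zero.1 ((map_sub f _ _).symm.trans
          (hker (Submodule.subset_span ⟨n, h1, by omega, rfl⟩)))
  · rintro ⟨P, hP, hdeg, e, he⟩ htop
    let f : (Fin S → ZMod 2) →ₗ[ZMod 2] ZMod 2 := Fintype.linearCombination (ZMod 2)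
      (fun i : Fin S => P.coeff i)
    have hf (v : Fin S → ZMod 2) : f v = ∑ i : Fin S, P.coeff i * v i := by
      simp [f, Fintype.linearCombination_apply, mul_comm]
    have hle : (⊤ : Submodule (ZMod 2) (Fin S → ZMod 2)) ≤ LinearMap.ker f := by
      rw [← htop, Submodule.span_le]
      rintro _ ⟨n, h2, hn, rfl⟩
      rw [SetLike.mem_coe, LinearMap.mem_ker, hf]
      simp only [mul_sub, Finset.sum_sub_distrib]
      rw [← aeval_shiftEnd_apply s hdeg, ← aeval_shiftEnd_apply s hdeg,
        he n (by omega) (by omega), he 1 le_rfl (by omega), sub_self]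
    have h0 : f (Pi.single ⟨P.natDegree, hdeg⟩ 1) = 0 := hle trivial
    rw [hf, Finset.sum_eq_single ⟨P.natDegree, hdeg⟩ (fun i _ hi => by simp [hi])
      (by simp)] at h0
    simp [hP] at h0

section LinComplexity

variable (s : ℕ → ZMod 2) (N : ℕ)

lemma linComplexity_le : linComplexity s N ≤ N :=
  Nat.sInf_le ⟨0, fun n h1 h2 => by omega⟩

lemma exists_monic_natDegree_eq_linComplexity :
    ∃ P : (ZMod 2)[X], P.Monic ∧ P.natDegree = linComplexity s N ∧
      ∀ n, 1 ≤ n → n + linComplexity s N ≤ N → aeval (shiftEnd (ZMod 2)) P s n = 0 := by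
  rw [← exists_recurrence_iff_exists_monic]
  exact Nat.sInf_mem (s := {L : ℕ | ∃ c : Fin L → ZMod 2, ∀ n : ℕ, 1 ≤ n → n + L ≤ N →
    s (n + L) = ∑ i : Fin L, c i * s (n + (i : ℕ))}) ⟨N, 0, fun n h1 h2 => by omega⟩

variable {s N}

lemma linComplexity_le_natDegree {Q : (ZMod 2)[X]} (hQ : Q ≠ 0)
    (h : ∀ n, 1 ≤ n → n + Q.natDegree ≤ N → aeval (shiftEnd (ZMod 2)) Q s n = 0) :
    linComplexity s N ≤ Q.natDegree := by
  refine Nat.sInf_le ((exists_recurrence_iff_exists_monic s N _).2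
    ⟨Q * C Q.leadingCoeff⁻¹, monic_mul_leadingCoeff_inv hQ,
      natDegree_mul_leadingCoeff_inv Q hQ, fun n h1 h2 => ?_⟩)
  rw [mul_comm, map_mul, Module.End.mul_apply, aeval_C, Module.algebraMap_end_apply,
    Pi.smul_apply, h n h1 h2, smul_zero]

lemma le_linComplexity_of_passesLatticeTest {S : ℕ} (h : passesLatticeTest s N S) :
    S ≤ linComplexity s N := by
  contrapose! h
  obtain ⟨P, hP, hdeg, hrec⟩ := exists_monic_natDegree_eq_linComplexity s N
  exact (not_passesLatticeTest_iff s N S).2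
    ⟨P, hP.ne_zero, hdeg ▸ h, 0, fun n h1 h2 => hrec n h1 (by omega)⟩

lemma le_sub_linComplexity_of_passesLatticeTest {S : ℕ} (h : passesLatticeTest s N S) :
    S ≤ N + 1 - linComplexity s N := by
  have hle := linComplexity_le s N
  contrapose! h
  rw [not_passesLatticeTest_iff]
  rcases Nat.eq_zero_or_pos (linComplexity s N) with h0 | hpos
  · exact ⟨1, one_ne_zero, by rw [natDegree_one]; omega, 0, fun n h1 h2 => by omega⟩
  · obtain ⟨Q, hQ, hdeg, hann⟩ := exists_annihilator_of_not_recurrence (s := s)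
      (d := linComplexity s N - 1) (M := N + 1 - linComplexity s N) (by
        rintro ⟨c, hc⟩
        have : linComplexity s N ≤ linComplexity s N - 1 :=
          Nat.sInf_le ⟨c, fun n h1 h2 => hc n h1 (by omega)⟩
        omega)
    exact ⟨Q, hQ, hdeg.trans h, 0, fun n h1 h2 => hann n h1 (by omega)⟩

lemma passesLatticeTest_of_lt {S : ℕ} (h1 : S < linComplexity s N)
    (h2 : S < N + 1 - linComplexity s N) : passesLatticeTest s N S := by
  by_contra h
  obtain ⟨B, hB, hdeg, e, he⟩ := (not_passesLatticeTest_iff s N S).1 h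
  obtain ⟨P, hP, hPdeg, hrec⟩ := exists_monic_natDegree_eq_linComplexity s N
  have hX : (X - 1 : (ZMod 2)[X]) ≠ 0 := by simpa using X_sub_C_ne_zero (1 : ZMod 2)
  have hXdeg : ((X - 1) * B : (ZMod 2)[X]).natDegree = B.natDegree + 1 := by
    rw [natDegree_mul hX hB, add_comm]
    simpa using natDegree_X_sub_C (1 : ZMod 2)
  have := linComplexity_le_natDegree (mul_ne_zero hX hB)
    (aeval_shiftEnd_eq_zero_of_initial (N := N) hP (hPdeg ▸ hrec) fun n hn hn' => by
      rw [map_mul, map_sub, aeval_X, map_one, Module.End.mul_apply, LinearMap.sub_apply,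
        Pi.sub_apply, Module.End.one_apply, shiftEnd, LinearMap.funLeft_apply, ← shiftEnd,
        he _ (by omega) (by omega), he _ hn (by omega), sub_self])
  omega

end LinComplexity

theorem stmt11 (s : ℕ → ZMod 2) (N : ℕ) (hN : 1 ≤ N) :
    latticeLevel s N = min (linComplexity s N) (N + 1 - linComplexity s N) ∨
      latticeLevel s N = min (linComplexity s N) (N + 1 - linComplexity s N) - 1 := by
  have hub : ∀ S ∈ {S : ℕ | 0 < S ∧ passesLatticeTest s N S},
      S ≤ min (linComplexity s N) (N + 1 - linComplexity s N) := fun S hS =>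
    le_min (le_linComplexity_of_passesLatticeTest hS.2)
      (le_sub_linComplexity_of_passesLatticeTest hS.2)
  have hle : latticeLevel s N ≤ min (linComplexity s N) (N + 1 - linComplexity s N) :=
    csSup_le' hub
  have hge : min (linComplexity s N) (N + 1 - linComplexity s N) - 1 ≤ latticeLevel s N := by
    rcases Nat.eq_zero_or_pos (min (linComplexity s N) (N + 1 - linComplexity s N) - 1) with
      h0 | hpos
    · omega
    · exact le_csSup ⟨_, hub⟩ ⟨hpos, passesLatticeTest_of_lt (by omega) (by omega)⟩
  omega
end

section
/- If a binary sequence S = (s_n)_{n=1}^∞ over 𝔽₂ satisfies s_{2n} = 1 - s_n for all n = 1, 2, …, then ⌊N/2⌋ ≤ L(S,N) ≤ ⌊N/2⌋ + 1 for all N ≥ 1. -/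
open scoped BigOperators

open Polynomial

/-- In characteristic two, squares are constants for the derivation. -/
lemma derivative_sq_mul_of_charTwo (p q : (ZMod 2)[X]) :
    derivative (p ^ 2 * q) = p ^ 2 * derivative q := by
  rw [derivative_mul, derivative_pow]
  simp [CharTwo.two_eq_zero]

/-- The Riccati equation `d(X y)/dX + y ^ 2 + X ^ 2 / (1 + X) ^ 2 = 0` has no rational solution
`y = P / C` over `𝔽₂`. -/
lemma eq_zero_of_riccati (C P : (ZMod 2)[X])
    (h : (1 + X) ^ 2 * (derivative (X * (P * C)) + P ^ 2) + X ^ 2 * C ^ 2 = 0) : C = 0 := by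
  have hD : (1 + X : (ZMod 2)[X]) = X - Polynomial.C 1 := by
    rw [map_one, CharTwo.sub_eq_add, add_comm]
  have hD0 : (1 + X : (ZMod 2)[X]) ≠ 0 := by rw [hD]; exact X_sub_C_ne_zero 1
  have hDdeg : (1 + X : (ZMod 2)[X]).natDegree = 1 := by rw [hD]; exact natDegree_X_sub_C 1
  have dvd_of_eval (p : (ZMod 2)[X]) (hp : p.eval 1 = 0) : (1 + X) ∣ p := by
    rw [hD]; exact dvd_iff_isRoot.2 hp
  have h11 : (1 + 1 : ZMod 2) = 0 := by decide
  induction hn : C.natDegree using Nat.strong_induction_on generalizing C P with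
  | _ n ih =>
    have hC1 : C.eval 1 = 0 := by
      have := congrArg (eval 1) h
      simpa [h11] using this
    obtain ⟨R, rfl⟩ := dvd_of_eval C hC1
    have hR : derivative (X * (P * ((1 + X) * R))) + P ^ 2 + X ^ 2 * R ^ 2 = 0 := by
      apply mul_left_cancel₀ (pow_ne_zero 2 hD0)
      linear_combination h
    have hev : P.eval 1 * R.eval 1 + P.eval 1 ^ 2 + R.eval 1 ^ 2 = 0 := by
      have := congrArg (eval 1) hR
      simpa [h11, derivative_mul] using this
    have key : ∀ a b : ZMod 2, a * b + a ^ 2 + b ^ 2 = 0 → a = 0 := by decide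
    obtain ⟨Q, rfl⟩ := dvd_of_eval P (key _ _ hev)
    by_contra hne
    have hR0 : R ≠ 0 := right_ne_zero_of_mul hne
    refine hR0 (ih R.natDegree ?_ R Q ?_ rfl)
    · rw [← hn, natDegree_mul hD0 hR0, hDdeg]
      omega
    · rw [show X * ((1 + X) * Q * ((1 + X) * R)) = (1 + X) ^ 2 * (X * (Q * R)) by ring,
        derivative_sq_mul_of_charTwo] at hR
      linear_combination hR

/-- The truncated generating polynomial `∑ s_n X ^ n`, `1 ≤ n ≤ N`. -/
noncomputable def truncGen (s : ℕ → ZMod 2) (N : ℕ) : (ZMod 2)[X] :=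
  ∑ n ∈ Finset.Icc 1 N, monomial n (s n)

lemma coeff_truncGen (s : ℕ → ZMod 2) (N n : ℕ) :
    (truncGen s N).coeff n = if 1 ≤ n ∧ n ≤ N then s n else 0 := by
  simp [truncGen, coeff_monomial]

lemma coeff_derivative_X_mul_add_sq (s : ℕ → ZMod 2)
    (hs : ∀ n : ℕ, 1 ≤ n → s (2 * n) = 1 - s n) {N m : ℕ} (hm : m ≤ N) :
    (derivative (X * truncGen s N) + truncGen s N ^ 2).coeff m =
      if 2 ∣ m ∧ m ≠ 0 then 1 else 0 := by
  have h2 : (2 : ZMod 2) = 0 := CharTwo.two_eq_zero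
  rw [← ZMod.expand_card, coeff_add, coeff_derivative, coeff_X_mul, coeff_expand two_pos,
    coeff_truncGen, coeff_truncGen]
  obtain ⟨k, rfl | rfl⟩ := m.even_or_odd'
  · rcases Nat.eq_zero_or_pos k with rfl | hk
    · simp
    · rw [if_pos (by omega), if_pos (by omega), if_pos (by omega), if_pos (by omega), hs k hk]
      have : 2 * k / 2 = k := by omega
      rw [this]
      push_cast
      linear_combination (1 - s k) * k * h2
  · rw [if_neg (by omega : ¬ 2 ∣ 2 * k + 1), if_neg (by omega : ¬ (2 ∣ 2 * k + 1 ∧ _)),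
      if_pos (by omega)]
    push_cast
    linear_combination s (2 * k + 1) * (k + 1) * h2

lemma X_pow_dvd_riccati_truncGen (s : ℕ → ZMod 2)
    (hs : ∀ n : ℕ, 1 ≤ n → s (2 * n) = 1 - s n) (N : ℕ) :
    X ^ (N + 1) ∣ (1 + X) ^ 2 * (derivative (X * truncGen s N) + truncGen s N ^ 2) + X ^ 2 := by
  rw [X_pow_dvd_iff]
  intro m hm
  rw [CharTwo.add_sq, one_pow, add_mul, one_mul, coeff_add, coeff_add,
    coeff_derivative_X_mul_add_sq s hs (by omega), coeff_X_pow_mul', coeff_X_pow]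
  have h11 : (1 + 1 : ZMod 2) = 0 := by decide
  by_cases h2 : 2 ≤ m
  · rw [if_pos h2, coeff_derivative_X_mul_add_sq s hs (by omega)]
    obtain rfl | hm2 := eq_or_ne m 2
    · simp [h11]
    · by_cases hd : 2 ∣ m
      · rw [if_pos (by omega), if_pos (by omega), if_neg hm2, add_zero, h11]
      · rw [if_neg (by omega), if_neg (by omega), if_neg hm2, add_zero, add_zero]
  · rw [if_neg (by omega), if_neg (by omega), if_neg (by omega), add_zero, add_zero]

lemma div_two_le_of_recurrence (s : ℕ → ZMod 2)
    (hs : ∀ n : ℕ, 1 ≤ n → s (2 * n) = 1 - s n) {N L : ℕ} (c : Fin L → ZMod 2)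
    (hc : ∀ n : ℕ, 1 ≤ n → n + L ≤ N → s (n + L) = ∑ i : Fin L, c i * s (n + (i : ℕ))) :
    N / 2 ≤ L := by
  by_contra! hlt
  set G := truncGen s N with hG
  set Q : (ZMod 2)[X] := 1 + ∑ i : Fin L, Polynomial.C (c i) * X ^ (L - (i : ℕ)) with hQ
  have hQdeg : Q.natDegree ≤ L := by
    refine natDegree_add_le_of_degree_le (by simp) (natDegree_sum_le_of_forall_le _ _ ?_)
    intro i _
    exact (natDegree_C_mul_X_pow_le _ _).trans (Nat.sub_le _ _)
  have hQ0 : Q ≠ 0 := by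
    intro h0
    have := congrArg (fun p => coeff p 0) h0
    simp only [hQ, coeff_add, finsetSum_coeff, coeff_C_mul, coeff_X_pow, coeff_one_zero,
      coeff_zero] at this
    rw [Finset.sum_eq_zero] at this
    · simp at this
    · intro i _
      rw [if_neg (by omega), mul_zero]
  have hcoeff (n : ℕ) (hn : L < n) (hnN : n ≤ N) : (Q * G).coeff n = 0 := by
    rw [hQ, add_mul, one_mul, Finset.sum_mul, coeff_add, finsetSum_coeff, hG, coeff_truncGen,
      if_pos (by omega)]
    have h1 := hc (n - L) (by omega) (by omega)
    rw [Nat.sub_add_cancel hn.le] at h1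
    rw [h1, ← CharTwo.sub_eq_add, sub_eq_zero]
    refine Finset.sum_congr rfl fun i _ => ?_
    rw [mul_assoc, coeff_C_mul, coeff_X_pow_mul', if_pos (by omega), coeff_truncGen,
      if_pos (by omega)]
    congr 2
    omega
  set P : (ZMod 2)[X] := ∑ i ∈ Finset.range (L + 1), monomial i ((Q * G).coeff i) with hP
  have hPdeg : P.natDegree ≤ L :=
    natDegree_sum_le_of_forall_le _ _ fun i hi =>
      (natDegree_monomial_le _).trans (by simpa [Nat.lt_succ_iff] using hi)
  have hPG : X ^ (N + 1) ∣ P - Q * G := by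
    rw [X_pow_dvd_iff]
    intro n hn
    by_cases hnL : n ≤ L
    · simp [hP, coeff_monomial, hnL]
    · simp [hP, coeff_monomial, hnL, hcoeff n (by omega) (by omega)]
  obtain ⟨H, hH⟩ := hPG
  obtain ⟨K, hK⟩ := X_pow_dvd_riccati_truncGen s hs N
  have hder : X ^ (N + 1) ∣ derivative (X * (P * Q)) - Q ^ 2 * derivative (X * G) := by
    rw [← derivative_sq_mul_of_charTwo, ← derivative_sub,
      show X * (P * Q) - Q ^ 2 * (X * G) = X ^ (N + 2) * (H * Q) by
        linear_combination X * Q * hH, derivative_mul, derivative_X_pow]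
    refine dvd_add ?_ ?_
    · exact ((dvd_mul_left _ _)).mul_right _
    · exact (pow_dvd_pow _ (by omega)).mul_right _
  obtain ⟨J, hJ⟩ := hder
  refine hQ0 (eq_zero_of_riccati Q P ?_)
  set A := (1 + X) ^ 2 * (derivative (X * (P * Q)) + P ^ 2) + X ^ 2 * Q ^ 2 with hA
  have hdvd : X ^ (N + 1) ∣ A := by
    refine ⟨Q ^ 2 * K + (1 + X) ^ 2 * (J + (P + Q * G) * H), ?_⟩
    linear_combination Q ^ 2 * hK + (1 + X) ^ 2 * hJ + (1 + X) ^ 2 * (P + Q * G) * hH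
  have hAdeg : A.natDegree ≤ 2 * L + 2 := by
    have h1 : ((1 + X : (ZMod 2)[X]) ^ 2).natDegree ≤ 2 := by compute_degree
    have hPQ : (P * Q).natDegree ≤ L + L := natDegree_mul_le_of_le hPdeg hQdeg
    have h2 : (derivative (X * (P * Q))).natDegree ≤ 2 * L := by
      refine (natDegree_derivative_le _).trans ?_
      have := natDegree_mul_le_of_le (natDegree_X_le (R := ZMod 2)) hPQ
      omega
    have h3 := natDegree_pow_le_of_le 2 hPdeg
    have h4 := natDegree_pow_le_of_le 2 hQdeg
    refine natDegree_add_le_of_degree_le ?_ ?_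
    · have := natDegree_mul_le_of_le h1 (natDegree_add_le_of_degree_le h2 h3)
      omega
    · have := natDegree_mul_le_of_le (natDegree_X_pow_le (R := ZMod 2) 2) h4
      omega
  by_contra hA0
  have := natDegree_le_of_dvd hdvd hA0
  rw [natDegree_X_pow] at this
  omega

lemma exists_recurrence (s : ℕ → ZMod 2)
    (hs : ∀ n : ℕ, 1 ≤ n → s (2 * n) = 1 - s n) {N M : ℕ} (hNM : N < 2 * M) :
    ∃ c : Fin M → ZMod 2,
      ∀ n : ℕ, 1 ≤ n → n + M ≤ N → s (n + M) = ∑ i : Fin M, c i * s (n + (i : ℕ)) := by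
  by_contra hno
  let w : ℕ → Fin (N - M) → ZMod 2 := fun j k => s (1 + (k : ℕ) + j)
  have hw : w M ∉ Submodule.span (ZMod 2) (Set.range fun i : Fin M => w i) := by
    intro hmem
    obtain ⟨c, hc⟩ := (Submodule.mem_span_range_iff_exists_fun _).1 hmem
    refine hno ⟨c, fun n hn hnM => ?_⟩
    have := congrFun hc ⟨n - 1, by omega⟩
    simp only [w, Finset.sum_apply, Pi.smul_apply, smul_eq_mul] at this
    rw [Nat.add_sub_cancel' hn] at this
    exact this.symm
  obtain ⟨f, hfM, hf⟩ := Submodule.exists_le_ker_of_notMem hw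
  set d : Fin (N - M) → ZMod 2 := fun k => f (fun j => if k = j then 1 else 0) with hd
  have hfw (j : ℕ) : f (w j) = ∑ k : Fin (N - M), s (1 + (k : ℕ) + j) * d k := by
    rw [LinearMap.pi_apply_eq_sum_univ f (w j)]
    rfl
  have hf0 (j : ℕ) (hj : j < M) : ∑ k : Fin (N - M), s (1 + (k : ℕ) + j) * d k = 0 := by
    rw [← hfw]
    exact hf (Submodule.subset_span ⟨⟨j, hj⟩, rfl⟩)
  have hne : (Finset.univ.filter fun k => d k ≠ 0).Nonempty := by
    by_contra hemp
    rw [Finset.not_nonempty_iff_eq_empty, Finset.filter_eq_empty_iff] at hemp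
    refine hfM ?_
    rw [hfw]
    refine Finset.sum_eq_zero fun k hk => ?_
    rw [not_not.1 (hemp hk), mul_zero]
  obtain ⟨r, hr, hmax⟩ := Finset.exists_max_image _ (fun k => k) hne
  have hdr : d r = 1 := by
    have key : ∀ a : ZMod 2, a ≠ 0 → a = 1 := by decide
    exact key _ (Finset.mem_filter.1 hr).2
  have hlow := div_two_le_of_recurrence s hs (N := r + M) (L := r)
    (fun i => d ⟨i, i.2.trans r.2⟩) (by
      intro n hn hnr
      have h0 := hf0 (n - 1) (by omega)
      have hsplit : ∑ k : Fin (N - M), s (1 + (k : ℕ) + (n - 1)) * d k =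
          s (n + r) + ∑ i : Fin r, d ⟨i, i.2.trans r.2⟩ * s (n + (i : ℕ)) := by
        let g : ℕ → ZMod 2 := fun k => if h : k < N - M then d ⟨k, h⟩ * s (n + k) else 0
        have e1 : ∑ k : Fin (N - M), s (1 + (k : ℕ) + (n - 1)) * d k = ∑ k ∈ Finset.range (N - M), g k := by
          rw [← Fin.sum_univ_eq_sum_range]
          refine Finset.sum_congr rfl fun k _ => ?_
          simp only [g, k.2, dif_pos, Fin.eta]
          rw [mul_comm, show 1 + (k : ℕ) + (n - 1) = n + k by omega]
        have e2 : ∑ i : Fin r, d ⟨i, i.2.trans r.2⟩ * s (n + (i : ℕ)) =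
            ∑ k ∈ Finset.range r, g k := by
          rw [← Fin.sum_univ_eq_sum_range]
          refine Finset.sum_congr rfl fun k _ => ?_
          simp only [g, k.2.trans r.2, dif_pos]
        have e3 : s (n + r) = g r := by simp [g, hdr]
        rw [e1, e2, e3, add_comm, ← Finset.sum_range_succ]
        symm
        refine Finset.sum_subset (Finset.range_subset_range.2 r.2) fun k hk hk' => ?_
        simp only [Finset.mem_range] at hk hk'
        simp only [g, hk, dif_pos]
        by_cases hdk : d ⟨k, hk⟩ = 0
        · rw [hdk, zero_mul]
        · have := hmax ⟨k, hk⟩ (Finset.mem_filter.2 ⟨Finset.mem_univ _, hdk⟩)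
          rw [Fin.le_def] at this
          simp only at this
          omega
      rw [hsplit] at h0
      exact CharTwo.add_eq_zero.1 h0)
  have := r.2
  omega

theorem stmt13 (s : ℕ → ZMod 2)
    (hs : ∀ n : ℕ, 1 ≤ n → s (2 * n) = 1 - s n) :
    ∀ N : ℕ, 1 ≤ N →
      N / 2 ≤ linComplexity s N ∧ linComplexity s N ≤ N / 2 + 1 := by
  intro N _
  let T : Set ℕ := {L : ℕ | ∃ c : Fin L → ZMod 2,
    ∀ n : ℕ, 1 ≤ n → n + L ≤ N → s (n + L) = ∑ i : Fin L, c i * s (n + (i : ℕ))}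
  have hmem : N / 2 + 1 ∈ T := exists_recurrence s hs (by omega)
  refine ⟨?_, Nat.sInf_le hmem⟩
  obtain ⟨c, hc⟩ := Nat.sInf_mem ⟨_, hmem⟩
  exact div_two_le_of_recurrence s hs c hc
end

section
/- Let p be a prime with p ≡ 3 (mod 8) or p ≡ 5 (mod 8) (equivalently p ≡ ±3 mod 8), and let L_p be the p-periodic Legendre sequence. Then for all N ≥ 1, ⌈(min{N, 2p-1} - 1)/2⌉ ≤ L(L_p, N) ≤ ⌊min{N, 2p-2}/2⌋ + 1. -/
open scoped BigOperators

open scoped Polynomial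

open Polynomial in
/-- The linear functional on `𝔽₂[X]` sending `X ^ k` to `a k`. -/
noncomputable def momentFunctional (a : ℕ → ZMod 2) : (ZMod 2)[X] →ₗ[ZMod 2] ZMod 2 :=
  (basisMonomials (ZMod 2)).constr (ZMod 2) a

open Polynomial in
theorem momentFunctional_X_pow (a : ℕ → ZMod 2) (k : ℕ) :
    momentFunctional a (X ^ k) = a k := by
  have h := (basisMonomials (ZMod 2)).constr_basis (ZMod 2) a k
  rwa [coe_basisMonomials, show (fun s => monomial s (1 : ZMod 2)) k = X ^ k from
    monomial_one_right_eq_X_pow k] at h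

open Polynomial in
theorem momentFunctional_X_pow_mul_sum (a : ℕ → ZMod 2) (k n : ℕ) (c : Fin n → ZMod 2) :
    momentFunctional a (X ^ k * ∑ i : Fin n, c i • X ^ (i : ℕ)) =
      ∑ i : Fin n, c i * a (k + i) := by
  simp only [Finset.mul_sum, mul_smul_comm, ← pow_add, map_sum, map_smul,
    momentFunctional_X_pow, smul_eq_mul]

theorem Polynomial.degreeLT_induction {R : Type*} [Semiring R] {n : ℕ} {P : R[X] → Prop}
    (pow : ∀ k < n, P (Polynomial.X ^ k)) (zero : P 0)
    (h_add : ∀ f g, P f → P g → P (f + g)) (smul : ∀ (c : R) f, P f → P (c • f))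
    {f : R[X]} (hf : f ∈ degreeLT R n) : P f := by
  classical
  rw [degreeLT_eq_span_X_pow] at hf
  refine Submodule.span_induction (p := fun f _ => P f) ?_ zero
    (fun f g _ _ => h_add f g) (fun c f _ => smul c f) hf
  intro x hx
  simp only [Finset.coe_image, Set.mem_image, Finset.coe_range, Set.mem_Iio] at hx
  obtain ⟨k, hk, rfl⟩ := hx
  exact pow k hk

open Polynomial in
theorem momentFunctional_mul_eq_zero {a : ℕ → ZMod 2} {n : ℕ} {f q : (ZMod 2)[X]}
    (hf : ∀ k < n, momentFunctional a (X ^ k * f) = 0) (hq : q ∈ degreeLT (ZMod 2) n) :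
    momentFunctional a (q * f) = 0 := by
  refine degreeLT_induction (P := fun q => momentFunctional a (q * f) = 0) hf (by simp)
    (fun g h hg hh => ?_) (fun c g hg => ?_) hq
  · rw [add_mul, map_add, hg, hh, add_zero]
  · rw [smul_mul_assoc, map_smul, hg, smul_zero]

open Polynomial in
theorem momentFunctional_X_mul_sq {a : ℕ → ZMod 2} {n : ℕ}
    (ha : ∀ i < n, a (2 * i + 2) = a (2 * i + 1) + a i)
    {g : (ZMod 2)[X]} (hg : g ∈ degreeLT (ZMod 2) n) :
    momentFunctional a ((X * g) ^ 2) =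
      momentFunctional a (X * g ^ 2) + momentFunctional a g := by
  refine degreeLT_induction (P := fun g => momentFunctional a ((X * g) ^ 2) =
      momentFunctional a (X * g ^ 2) + momentFunctional a g) (fun k hk => ?_) (by simp)
    (fun g h hg hh => ?_) (fun c g hg => ?_) hg
  · rw [← pow_succ', ← pow_mul, ← pow_mul, ← pow_succ', momentFunctional_X_pow,
      momentFunctional_X_pow, momentFunctional_X_pow, mul_comm k 2, ← ha k hk]
    congr 1
    ring
  · simp only [mul_add, CharTwo.add_sq, map_add, hg, hh]
    ring
  · have hc : c ^ 2 = c := ZMod.pow_card c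
    rw [mul_smul_comm, _root_.smul_pow, _root_.smul_pow, hc, mul_smul_comm, map_smul, map_smul, map_smul, hg,
      smul_add]

open Polynomial in
/-- The Hankel forms of a sequence over `𝔽₂` with `a 0 = 1` and
`a (2 * i + 2) = a (2 * i + 1) + a i` are nondegenerate. -/
theorem eq_zero_of_momentFunctional_eq_zero {a : ℕ → ZMod 2} (a_zero : a 0 = 1) {n : ℕ}
    (ha : ∀ i, i + 1 < n → a (2 * i + 2) = a (2 * i + 1) + a i)
    {f : (ZMod 2)[X]} (hdeg : f ∈ degreeLT (ZMod 2) n)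
    (hf : ∀ k < n, momentFunctional a (X ^ k * f) = 0) : f = 0 := by
  induction n generalizing f with
  | zero => simpa [mem_degreeLT] using hdeg
  | succ n ih =>
    have hg : f.divX ∈ degreeLT (ZMod 2) n := by
      rw [mem_degreeLT, degree_lt_iff_coeff_zero] at hdeg ⊢
      intro m hm
      rw [coeff_divX]
      exact hdeg _ (by lia)
    have hg' : f.divX ∈ degreeLT (ZMod 2) (n + 1) := degreeLT_mono n.le_succ hg
    have hff := momentFunctional_mul_eq_zero hf hdeg
    have hgf := momentFunctional_mul_eq_zero hf hg'
    have hsq := momentFunctional_X_mul_sq (n := n) (fun i hi => ha i (by lia)) hg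
    have hdiv := f.divX_mul_X_add
    set g := f.divX
    have hone : momentFunctional a 1 = 1 := by
      rw [← pow_zero X, momentFunctional_X_pow, a_zero]
    rcases (by decide : ∀ c : ZMod 2, c = 0 ∨ c = 1) (f.coeff 0) with h0 | h0
    · rw [h0, map_zero, add_zero] at hdiv
      have hgf' : momentFunctional a (X * g ^ 2) = 0 := by
        rw [← hgf, ← hdiv]
        congr 1
        ring
      have hphi : momentFunctional a g = 0 := by
        rw [hgf', zero_add] at hsq
        rw [← hsq, ← hff, ← hdiv]
        congr 1
        ring
      have hzero : g = 0 := by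
        refine ih (fun i hi => ha i (by lia)) hg fun k hk => ?_
        cases k with
        | zero => simpa using hphi
        | succ k =>
          rw [← hf k (by lia), ← hdiv]
          congr 1
          ring
      rw [← hdiv, hzero, zero_mul]
    · exfalso
      rw [h0, map_one] at hdiv
      have h1 : momentFunctional a (X * g ^ 2) + momentFunctional a g = 0 := by
        rw [← map_add, ← hgf, ← hdiv]
        congr 1
        ring
      have h2 : momentFunctional a ((X * g) ^ 2) + momentFunctional a 1 = 0 := by
        have hsum : (X * g) ^ 2 + 1 = f * f := by
          rw [← hdiv, ← pow_two (g * X + 1), CharTwo.add_sq (g * X) 1, one_pow, mul_comm g]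
        rw [← map_add, hsum, hff]
      rw [hsq, h1, hone, zero_add] at h2
      exact one_ne_zero h2

open Polynomial in
/-- A lower bound for the length of a linear recurrence satisfied by `a 0, …, a (2 * L)`. -/
theorem not_recurrence_of_apwenian {a : ℕ → ZMod 2} (a_zero : a 0 = 1) {L : ℕ}
    (ha : ∀ i < L, a (2 * i + 2) = a (2 * i + 1) + a i) (c : Fin L → ZMod 2) :
    ¬ ∀ k ≤ L, a (k + L) = ∑ i : Fin L, c i * a (k + i) := by
  intro h
  let r : (ZMod 2)[X] := ∑ i : Fin L, c i • X ^ (i : ℕ)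
  have hr : r.degree < (L : WithBot ℕ) := by
    rw [← mem_degreeLT]
    refine Submodule.sum_mem _ fun i _ => Submodule.smul_mem _ _ ?_
    rw [mem_degreeLT, degree_X_pow]
    exact_mod_cast i.2
  have hmonic : (X ^ L - r).Monic := monic_X_pow_sub hr
  refine hmonic.ne_zero (eq_zero_of_momentFunctional_eq_zero (a := a) (n := L + 1) a_zero
    (fun i hi => ha i (by lia)) ?_ fun k hk => ?_)
  · refine Submodule.sub_mem _ ?_ (degreeLT_mono L.le_succ (mem_degreeLT.2 hr))
    rw [mem_degreeLT, degree_X_pow]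
    exact_mod_cast L.lt_succ_self
  · rw [mul_sub, map_sub, momentFunctional_X_pow_mul_sum, ← pow_add, momentFunctional_X_pow,
      h k (by lia), sub_self]

open Polynomial in
theorem exists_recurrence_of_apwenian {a : ℕ → ZMod 2} (a_zero : a 0 = 1) {n : ℕ}
    (ha : ∀ i, i + 1 < n → a (2 * i + 2) = a (2 * i + 1) + a i) :
    ∃ c : Fin n → ZMod 2, ∀ k < n, a (k + n) = ∑ i : Fin n, c i * a (k + i) := by
  let A : Matrix (Fin n) (Fin n) (ZMod 2) := Matrix.of fun i j => a (i + j)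
  have hinj : Function.Injective A.mulVecLin := by
    rw [← LinearMap.ker_eq_bot, LinearMap.ker_eq_bot']
    intro c hc
    have hdeg : ∑ i : Fin n, c i • X ^ (i : ℕ) ∈ degreeLT (ZMod 2) n := by
      refine Submodule.sum_mem _ fun i _ => Submodule.smul_mem _ _ ?_
      rw [mem_degreeLT, degree_X_pow]
      exact_mod_cast i.2
    have hzero := eq_zero_of_momentFunctional_eq_zero a_zero ha hdeg fun k hk => by
      rw [momentFunctional_X_pow_mul_sum]
      simpa [A, Matrix.mulVecLin_apply, Matrix.mulVec, dotProduct, mul_comm]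
        using congrFun hc ⟨k, hk⟩
    ext j
    have := congrArg (fun q => q.coeff (j : ℕ)) hzero
    simpa [finsetSum_coeff, coeff_X_pow, Fin.val_inj] using this
  obtain ⟨c, hc⟩ := LinearMap.injective_iff_surjective.1 hinj fun k => a (k + n)
  refine ⟨c, fun k hk => ?_⟩
  simpa [A, Matrix.mulVec, dotProduct, mul_comm] using (congrFun hc ⟨k, hk⟩).symm

/-- A sequence whose consecutive sums satisfy a linear recurrence of length `n` satisfies one of
length `n + 1`. -/
theorem exists_recurrence_of_consecutive_sums {s : ℕ → ZMod 2} {n : ℕ} (c : Fin n → ZMod 2) :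
    ∃ c' : Fin (n + 1) → ZMod 2, ∀ m,
      s (m + n) + s (m + n + 1) = ∑ i : Fin n, c i * (s (m + i) + s (m + i + 1)) →
      s (m + (n + 1)) = ∑ i : Fin (n + 1), c' i * s (m + i) := by
  refine ⟨Fin.snoc (α := fun _ => ZMod 2) c 1 + Fin.cons (α := fun _ => ZMod 2) 0 c, ?_⟩
  intro m h
  simp only [Pi.add_apply, add_mul, Finset.sum_add_distrib]
  rw [Fin.sum_univ_castSucc, Fin.sum_univ_succ (fun i => Fin.cons (α := fun _ => ZMod 2) 0 c i * _)]
  simp only [mul_add, Finset.sum_add_distrib] at h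
  simp only [Fin.snoc_castSucc, Fin.snoc_last, Fin.cons_zero, Fin.cons_succ, Fin.val_castSucc,
    Fin.val_last, Fin.val_succ, zero_mul, zero_add, one_mul, ← add_assoc]
  have h2 := CharTwo.add_self_eq_zero (s (m + n))
  linear_combination h - h2

section Legendre

variable {p : ℕ} [Fact p.Prime] {l : ℕ → ZMod 2}

theorem neg_one_pow_val_injective {a b : ZMod 2} (h : (-1 : ℤ) ^ a.val = (-1) ^ b.val) :
    a = b := by
  revert a b
  decide

theorem legendreSequence_two_mul (hp : p % 8 = 3 ∨ p % 8 = 5)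
    (hl : ∀ n : ℕ, ¬ p ∣ n → legendreSym p n = (-1) ^ (l n).val) {n : ℕ} (hn : ¬ p ∣ n) :
    l (2 * n) = l n + 1 := by
  have hpp : p.Prime := Fact.out
  have htwo : legendreSym p 2 = -1 := by
    rw [legendreSym.at_two (by lia), ZMod.χ₈_nat_eq_if_mod_eight, if_neg (by lia), if_neg (by lia)]
  have h2n : ¬ p ∣ 2 * n := by
    rw [hpp.dvd_mul, not_or]
    refine ⟨fun h => ?_, hn⟩
    have := Nat.le_of_dvd two_pos h
    lia
  have h := hl _ h2n
  rw [Nat.cast_mul, legendreSym.mul, Nat.cast_ofNat, htwo, hl n hn] at h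
  apply neg_one_pow_val_injective
  rw [← h]
  generalize l n = x
  revert x
  decide

theorem legendreSequence_add_period
    (hl : ∀ n : ℕ, ¬ p ∣ n → legendreSym p n = (-1) ^ (l n).val)
    (hl0 : ∀ n : ℕ, p ∣ n → l n = 0) (n : ℕ) : l (n + p) = l n := by
  by_cases hn : p ∣ n
  · rw [hl0 n hn, hl0 _ (hn.add dvd_rfl)]
  · apply neg_one_pow_val_injective
    rw [← hl n hn, ← hl _ (by rwa [Nat.dvd_add_self_right])]
    simp [legendreSym]

theorem legendreSequence_one (hl : ∀ n : ℕ, ¬ p ∣ n → legendreSym p n = (-1) ^ (l n).val) :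
    l 1 = 0 := by
  have hpp : p.Prime := Fact.out
  have h := hl 1 (Nat.not_dvd_of_pos_of_lt one_pos hpp.one_lt)
  apply neg_one_pow_val_injective
  rw [← h]
  simp

/-- The consecutive sums of a Legendre sequence, for `p ≡ ±3 [MOD 8]`, start like an apwenian
sequence. -/
theorem legendreSequence_consecutive_sums (hp : p % 8 = 3 ∨ p % 8 = 5)
    (hl : ∀ n : ℕ, ¬ p ∣ n → legendreSym p n = (-1) ^ (l n).val) :
    l 1 + l 2 = 1 ∧ ∀ i, i + 2 < p →
      l (2 * i + 3) + l (2 * i + 4) = (l (2 * i + 2) + l (2 * i + 3)) + (l (i + 1) + l (i + 2)) := by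
  have hpp : p.Prime := Fact.out
  constructor
  · have h := legendreSequence_two_mul hp hl (Nat.not_dvd_of_pos_of_lt one_pos hpp.one_lt)
    rw [legendreSequence_one hl, mul_one, zero_add] at h
    rw [legendreSequence_one hl, h, zero_add]
  · intro i hi
    have h1 := legendreSequence_two_mul hp hl (Nat.not_dvd_of_pos_of_lt i.succ_pos (by lia))
    have h2 := legendreSequence_two_mul hp hl (Nat.not_dvd_of_pos_of_lt (i + 1).succ_pos hi)
    have e1 : l (2 * i + 2) = l (i + 1) + 1 := h1
    have e2 : l (2 * i + 4) = l (i + 2) + 1 := h2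
    rw [e1, e2]
    have h3 := CharTwo.add_self_eq_zero (l (i + 1))
    linear_combination -h3

end Legendre

theorem stmt14 (p : ℕ) [Fact p.Prime] (hp : p % 8 = 3 ∨ p % 8 = 5)
    (l : ℕ → ZMod 2)
    (hl : ∀ n : ℕ, ¬ p ∣ n → legendreSym p n = (-1) ^ (l n).val)
    (hl0 : ∀ n : ℕ, p ∣ n → l n = 0) :
    ∀ N : ℕ, 1 ≤ N →
      ⌈(((min N (2 * p - 1) : ℕ) : ℚ) - 1) / 2⌉ ≤ (linComplexity l N : ℤ) ∧
        (linComplexity l N : ℤ) ≤ ⌊((min N (2 * p - 2) : ℕ) : ℚ) / 2⌋ + 1 := by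
  intro N hN
  have hpp : p.Prime := Fact.out
  obtain ⟨h0, hrec⟩ := legendreSequence_consecutive_sums hp hl
  have upper : linComplexity l N ≤ min N (2 * p - 2) / 2 + 1 := by
    rcases le_total N (2 * p - 2) with h | h
    · rw [min_eq_left h]
      obtain ⟨c, hc⟩ := exists_recurrence_of_apwenian (a := fun k => l (k + 1) + l (k + 2))
        (n := N / 2) h0 fun i hi => hrec i (by lia)
      obtain ⟨c', hc'⟩ := exists_recurrence_of_consecutive_sums (s := l) c
      refine Nat.sInf_le ⟨c', fun m hm hmN => hc' m ?_⟩
      obtain ⟨k, rfl⟩ := Nat.exists_eq_add_of_le' hm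
      convert hc k (by lia) using 2 <;> grind
    · have hp2 : min N (2 * p - 2) / 2 + 1 = p := by
        have := hpp.two_le
        lia
      rw [hp2]
      refine Nat.sInf_le ⟨Pi.single ⟨0, hpp.pos⟩ 1, fun n _ _ => ?_⟩
      simp [legendreSequence_add_period hl hl0, Pi.single_apply]
  have lower : min N (2 * p - 1) ≤ 2 * linComplexity l N + 1 := by
    have hmem : linComplexity l N ∈ {L : ℕ | ∃ c : Fin L → ZMod 2,
        ∀ n : ℕ, 1 ≤ n → n + L ≤ N → l (n + L) = ∑ i : Fin L, c i * l (n + (i : ℕ))} :=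
      Nat.sInf_mem ⟨N, 0, fun n _ _ => by lia⟩
    obtain ⟨c, hc⟩ := hmem
    by_contra! hlt
    refine not_recurrence_of_apwenian (a := fun k => l (k + 1) + l (k + 2)) h0
      (fun i hi => hrec i (by lia)) c fun k hk => ?_
    have h1 := hc (k + 1) (by lia) (by lia)
    have h2 := hc (k + 2) (by lia) (by lia)
    simp only [mul_add, Finset.sum_add_distrib]
    rw [add_right_comm k _ 1, add_right_comm k _ 2, h1, h2]
    simp only [add_right_comm k]
  constructor
  · rw [Int.ceil_le, div_le_iff₀ two_pos, sub_le_iff_le_add]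
    have : ((min N (2 * p - 1) : ℕ) : ℚ) ≤ ((2 * linComplexity l N + 1 : ℕ) : ℚ) :=
      Nat.cast_le.2 lower
    push_cast at this ⊢
    linarith
  · have : ⌊((min N (2 * p - 2) : ℕ) : ℚ) / 2⌋ = ((min N (2 * p - 2) / 2 : ℕ) : ℤ) := by
      simpa using Rat.floor_intCast_div_natCast (min N (2 * p - 2) : ℕ) 2
    rw [this]
    exact_mod_cast upper
end
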